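/- For every choice of revealing probabilities {p_t}_{t=1}^∞ ⊆ [0,1], the error probabilities satisfy inf over all sequences {p_t} of limsup_{t→∞} t·E_t = κ*(a,b), where κ*(a,b) := 1/(1 + ((a/b − 1)/log(a/b))·(log((a/b − 1)/log(a/b)) − 1)). -/

import Mathlib

open MeasureTheory ProbabilityTheory Filter Asymptotics
open scoped ENNReal NNReal

noncomputable section

/-- The constant `κ*(a,b)` from the paper. -/
def kappaStar (a b : ℝ) : ℝ :=
  1 / (1 + (a / b - 1) / Real.log (a / b) *
      (Real.log ((a / b - 1) / Real.log (a / b)) - 1))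

/-- The signal distribution: `signalProb a b i x = P(X_t = x | θ = i)`,
equal to `a/(a+b)` if `x = i` and `b/(a+b)` otherwise. -/
def signalProb (a b : ℝ) (i x : ℕ) : ℝ :=
  if x = i then a / (a + b) else b / (a + b)

/-- The D-likelihood `D_i^t = Q_i^t(Z_1,…,Z_{t-1},X_t)`: the conditional probability, given
`θ = i`, of observing the actions `Z_1,…,Z_{t-1}` and private signal `X_t` that actually
occurred at the sample point `ω`. -/
def Dlike {Ω : Type*} [MeasurableSpace Ω] (μ : Measure Ω) (θ : Ω → ℕ)
    (X Z : ℕ → Ω → ℕ) (t : ℕ) (i : ℕ) (ω : Ω) : ℝ :=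
  (μ {ω' | θ ω' = i ∧ (∀ s ∈ Finset.Icc 1 (t - 1), Z s ω' = Z s ω) ∧ X t ω' = X t ω}).toReal
    / (μ {ω' | θ ω' = i}).toReal

/-- The maximum a posteriori estimate of `θ` given `(Z_1,…,Z_{t-1},X_t)`, with ties broken
by following the private signal `X_t`.  (The prior on `θ` is uniform, so comparing the
posteriors amounts to comparing `D_1^t` and `D_2^t`.) -/
def mapEst {Ω : Type*} [MeasurableSpace Ω] (μ : Measure Ω) (θ : Ω → ℕ)
    (X Z : ℕ → Ω → ℕ) (t : ℕ) (ω : Ω) : ℕ :=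
  if Dlike μ θ X Z t 2 ω < Dlike μ θ X Z t 1 ω then 1
  else if Dlike μ θ X Z t 1 ω < Dlike μ θ X Z t 2 ω then 2
  else X t ω

/-- The L-likelihood `L_i^t = P_i(Z_1 = z_1, …, Z_t = z_t)` evaluated at the observed
actions. -/
def Llike {Ω : Type*} [MeasurableSpace Ω] (μ : Measure Ω) (θ : Ω → ℕ)
    (Z : ℕ → Ω → ℕ) (t : ℕ) (i : ℕ) (ω : Ω) : ℝ :=
  (μ {ω' | θ ω' = i ∧ ∀ s ∈ Finset.Icc 1 t, Z s ω' = Z s ω}).toReal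
    / (μ {ω' | θ ω' = i}).toReal

/-- The likelihood ratio `R_t = L_1^t / L_2^t` (with `R_0 = 1`). -/
def LR {Ω : Type*} [MeasurableSpace Ω] (μ : Measure Ω) (θ : Ω → ℕ)
    (Z : ℕ → Ω → ℕ) (t : ℕ) (ω : Ω) : ℝ :=
  Llike μ θ Z t 1 ω / Llike μ θ Z t 2 ω

/-- The sequential decision making model with Bayesians and revealers.
`θ` is the state of the world, uniform on `{1,2}`; given `θ`, the signals `X_t` are i.i.d.
with `P(X_t = θ | θ) = a/(a+b)`, the revealing indicators `I_t` are independent Bernoulli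
with `E[I_t] = p_t`, independent of everything else (this is the content of `joint`), and
the actions are `Z_t = X_t` if `I_t = 1` and `Z_t = MAP(Z_1,…,Z_{t-1},X_t)` if `I_t = 0`
(field `dynamics`).  Players are indexed by `t ≥ 1`; `Z 0` is set to the constant `1` for
definiteness. -/
structure IsCascade (a b : ℝ) (p : ℕ → ℝ) {Ω : Type*} [MeasurableSpace Ω]
    (μ : Measure Ω) (θ : Ω → ℕ) (X I Z : ℕ → Ω → ℕ) : Prop where
  prob : IsProbabilityMeasure μ
  theta_meas : Measurable θ
  X_meas : ∀ t, Measurable (X t)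
  I_meas : ∀ t, Measurable (I t)
  Z_meas : ∀ t, Measurable (Z t)
  p_mem : ∀ t : ℕ, 1 ≤ t → p t ∈ Set.Icc (0 : ℝ) 1
  theta_range : ∀ ω, θ ω = 1 ∨ θ ω = 2
  X_range : ∀ t ω, X t ω = 1 ∨ X t ω = 2
  I_range : ∀ t ω, I t ω = 0 ∨ I t ω = 1
  Z_zero : ∀ ω, Z 0 ω = 1
  joint : ∀ i : ℕ, i = 1 ∨ i = 2 → ∀ s : Finset ℕ, (∀ t ∈ s, 1 ≤ t) →
    ∀ x c : ℕ → ℕ, (∀ t, x t = 1 ∨ x t = 2) → (∀ t, c t = 0 ∨ c t = 1) →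
    (μ {ω | θ ω = i ∧ ∀ t ∈ s, X t ω = x t ∧ I t ω = c t}).toReal
      = 1 / 2 * ∏ t ∈ s, signalProb a b i (x t) * (if c t = 1 then p t else 1 - p t)
  dynamics : ∀ t : ℕ, 1 ≤ t → ∀ ω,
    Z t ω = if I t ω = 1 then X t ω else mapEst μ θ X Z t ω

/-- The error probability `E_t = P(Z_t ≠ θ)`. -/
def errProb {Ω : Type*} [MeasurableSpace Ω] (μ : Measure Ω) (θ : Ω → ℕ)
    (Z : ℕ → Ω → ℕ) (t : ℕ) : ℝ :=
  (μ {ω | Z t ω ≠ θ ω}).toReal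

/-- The probability that the MAP estimator is wrong at time `t`:
`P(MAP(Z_1,…,Z_{t-1},X_t) ≠ θ)`. -/
def mapErr {Ω : Type*} [MeasurableSpace Ω] (μ : Measure Ω) (θ : Ω → ℕ)
    (X Z : ℕ → Ω → ℕ) (t : ℕ) : ℝ :=
  (μ {ω | mapEst μ θ X Z t ω ≠ θ ω}).toReal


/-! ### Analytic constants -/

theorem constants_exist (a b : ℝ) (hb : 0 < b) (hab : b < a) (α β : ℝ)
    (hα : α = a / (a + b)) (hβ : β = b / (a + b)) :
    ∃ lam m σ γ : ℝ, 0 < lam ∧ lam = Real.log (α / β) ∧ 0 < m ∧ m * lam = α - β ∧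
      m = β ^ (1 - σ) * α ^ σ ∧ 1 / 2 ≤ σ ∧ σ ≤ 1 ∧ γ = (1 - σ) * β + σ * α - m ∧ 0 < γ ∧
      kappaStar a b = β / γ := by
  have hab0 : 0 < a + b := by linarith
  have ha : 0 < a := by linarith
  have hα0 : 0 < α := by rw [hα]; positivity
  have hβ0 : 0 < β := by rw [hβ]; positivity
  have hlt : β < α := by rw [hα, hβ]; gcongr
  have hr : a / b = α / β := by rw [hα, hβ]; field_simp
  have hr1 : 1 < α / β := by rw [one_lt_div hβ0]; exact hlt
  set lam := Real.log (α / β) with hlam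
  have hlam0 : 0 < lam := Real.log_pos hr1
  have hexp : Real.exp lam = α / β := Real.exp_log (by positivity)
  set R := (α / β - 1) / lam with hR
  have hRm : R * lam = α / β - 1 := by rw [hR]; field_simp
  have hlamlt : lam < α / β - 1 := Real.log_lt_sub_one_of_pos (by positivity) hr1.ne'
  have hR1 : 1 < R := by rw [hR, one_lt_div hlam0]; exact hlamlt
  have hR0 : 0 < R := by linarith
  -- upper bound
  have hRle : R ≤ α / β := by
    have h1 : 1 - (α / β)⁻¹ ≤ lam := Real.one_sub_inv_le_log_of_pos (by positivity)
    have h2 : (α / β) * (1 - (α / β)⁻¹) ≤ (α / β) * lam := by gcongr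
    have h3 : (α / β) * (1 - (α / β)⁻¹) = α / β - 1 := by field_simp
    rw [hR, div_le_iff₀ hlam0]; linarith
  have hRge : lam / 2 ≤ Real.log R := by
    rw [Real.le_log_iff_exp_le hR0, hR, le_div_iff₀ hlam0, ← hexp]
    have h := Real.self_le_sinh_iff.mpr (show 0 ≤ lam / 2 by positivity)
    rw [Real.sinh_eq] at h
    have h1 : Real.exp lam = Real.exp (lam/2) * Real.exp (lam/2) := by
      rw [← Real.exp_add]; ring_nf
    have h2 : Real.exp (lam/2) * Real.exp (-(lam/2)) = 1 := by
      rw [← Real.exp_add]; simp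
    have h3 : Real.exp (lam/2) * lam ≤
        Real.exp (lam/2) * (Real.exp (lam/2) - Real.exp (-(lam/2))) := by
      gcongr; linarith
    rw [h1]; linarith
  refine ⟨lam, β * R, Real.log R / lam, β + Real.log R / lam * (α - β) - β * R, hlam0, rfl,
    by positivity, ?_, ?_, ?_, ?_, by ring, ?_, ?_⟩
  · rw [mul_assoc, hRm]; field_simp
  · have : α = β * Real.exp lam := by rw [hexp]; field_simp
    rw [this, Real.mul_rpow hβ0.le (Real.exp_pos _).le, ← mul_assoc, ← Real.rpow_add hβ0,
      ← Real.exp_mul]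
    have : lam * (Real.log R / lam) = Real.log R := by field_simp
    rw [this, Real.exp_log hR0]; simp
  · rw [le_div_iff₀ hlam0]; linarith
  · rw [div_le_one hlam0, hlam]; exact Real.log_le_log hR0 hRle
  · have e : Real.log R / lam * (α - β) = β * R * Real.log R := by
      rw [hR]; field_simp
    rw [e]
    have h1 : 1 - R⁻¹ < Real.log R := by
      have := Real.log_lt_sub_one_of_pos (inv_pos.mpr hR0) (by
        intro h; rw [inv_eq_one] at h; linarith)
      rw [Real.log_inv] at this; linarith
    have h2 : R * (1 - R⁻¹) < R * Real.log R := by gcongr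
    have h3 : R * (1 - R⁻¹) = R - 1 := by field_simp
    have : 0 < β * (1 + R * Real.log R - R) := by apply mul_pos hβ0; linarith
    linarith
  · have e : Real.log R / lam * (α - β) = β * R * Real.log R := by
      rw [hR]; field_simp
    rw [e]
    unfold kappaStar
    rw [hr, ← hlam, ← hR]
    have : β + β * R * Real.log R - β * R = β * (1 + R * (Real.log R - 1)) := by ring
    rw [this, div_mul_eq_div_div, div_self hβ0.ne']

/-- the bump function -/
def bump (K x : ℝ) : ℝ := if 0 ≤ x ∧ x ≤ K then x * (K - x) ^ 2 else 0

theorem bump_nonneg (K x : ℝ) : 0 ≤ bump K x := by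
  unfold bump; split_ifs with h
  · have := h.1; positivity
  · exact le_rfl

theorem bump_le (K x : ℝ) (hK : 0 ≤ K) : bump K x ≤ K ^ 3 := by
  unfold bump; split_ifs with h
  · have h1 : (K - x) ^ 2 ≤ K ^ 2 := by
      apply pow_le_pow_left₀ <;> linarith [h.1, h.2]
    calc x * (K - x) ^ 2 ≤ K * K ^ 2 := by gcongr; exact h.2
      _ = K ^ 3 := by ring
  · positivity

theorem log_one_sub_bounds {y : ℝ} (h0 : 0 ≤ y) (h1 : y ≤ 1 / 2) :
    -y - 2 * y ^ 2 ≤ Real.log (1 - y) ∧ Real.log (1 - y) ≤ -y := by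
  constructor
  · have h := Real.one_sub_inv_le_log_of_pos (show 0 < 1 - y by linarith)
    refine le_trans ?_ h
    rw [inv_eq_one_div, le_sub_iff_add_le, ← le_sub_iff_add_le', div_le_iff₀ (by linarith)]
    nlinarith [mul_nonneg h0 h0, mul_nonneg (mul_nonneg h0 h0) (show 0 ≤ 1/2 - y by linarith)]
  · have := Real.log_le_sub_one_of_pos (show 0 < 1 - y by linarith); linarith

theorem bracket (e K x : ℝ) (he : 0 < e) (he1 : e ≤ 1) (hK : 5 ≤ K)
    (hK1 : 2 * K + 2 ≤ e * ((K - 2) ^ 2 / 9))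
    (hK2 : 3 ≤ e * (K - 1)) (hx0 : 0 ≤ x) (hxK : x ≤ K) :
    x * (K - x) ^ 2 + 1
      ≤ bump K (x - 1) + (K - x) * (K - 3 * x) + e * (x * (K - x) ^ 2) := by
  unfold bump
  by_cases h1 : 1 ≤ x
  · rw [if_pos ⟨by linarith, by linarith⟩]
    by_cases h2 : x ≤ (2 * K + 2) / 3
    · have : (K - 2) ^ 2 / 9 ≤ x * (K - x) ^ 2 := by
        have h3 : ((K - 2) / 3) ^ 2 ≤ (K - x) ^ 2 := by
          apply pow_le_pow_left₀ <;> linarith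
        nlinarith
      have : e * ((K - 2) ^ 2 / 9) ≤ e * (x * (K - x) ^ 2) := by gcongr
      nlinarith
    · push Not at h2
      have : 0 ≤ e * (x * (K - x) ^ 2) := by positivity
      nlinarith
  · push Not at h1
    rw [if_neg (by rintro ⟨h, _⟩; linarith)]
    have h3 : e * (K - 1) ≤ (1 - x + e * x) * (K - x) := by
      apply mul_le_mul _ (by linarith) (by linarith)
      · have : 0 ≤ e * x := by positivity
        linarith
      · nlinarith
    have h4 : 1 ≤ (K - x) * ((1 - x + e * x) * (K - x) - 2 * x) := by
      have : 1 ≤ (1 - x + e * x) * (K - x) - 2 * x := by linarith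
      nlinarith
    nlinarith

theorem fprime_le (K x : ℝ) (hx0 : 0 ≤ x) (hxK : x ≤ K) :
    (K - x) * (K - 3 * x) ≤ 2 * K ^ 2 := by
  nlinarith [mul_nonneg hx0 (sub_nonneg.mpr hxK), mul_nonneg hx0 hx0,
    mul_nonneg hx0 (hx0.trans hxK), sq_nonneg K]

theorem fprime_ge (K x : ℝ) (hx0 : 0 ≤ x) (hxK : x ≤ K) :
    -(2 * K ^ 2) ≤ (K - x) * (K - 3 * x) := by
  nlinarith [mul_nonneg hx0 (sub_nonneg.mpr hxK), mul_nonneg hx0 hx0,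
    mul_nonneg hx0 (hx0.trans hxK), sq_nonneg K, sq_nonneg (3 * x - 2 * K)]

set_option maxHeartbeats 2000000 in
theorem bump_step (α β lam m σ γ : ℝ) (hβ : 0 < β) (hlt : β < α) (hs : α + β = 1)
    (hlam : 0 < lam) (hm : 0 < m) (hml : m * lam = α - β) (hσ0 : 0 ≤ σ) (hσ1 : σ ≤ 1)
    (hγ : γ = (1 - σ) * β + σ * α - m) (ε : ℝ) (hε : 0 < ε) :
    ∃ K p0 : ℝ, 5 ≤ K ∧ 0 < p0 ∧ p0 ≤ 1 / 2 ∧ ∀ p x : ℝ, 0 ≤ p → p ≤ p0 → 0 ≤ x → x ≤ K →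
      (1 - (γ + ε) * p) * bump K x ≤ p * m * bump K (x - 1) +
        (1 - p * β) ^ (1 - σ) * (1 - p * α) ^ σ *
          bump K (x + Real.log ((1 - p * β) / (1 - p * α)) / lam) := by
  set e := min (ε / m) 1 with he
  have he0 : 0 < e := lt_min (by positivity) one_pos
  have he1 : e ≤ 1 := min_le_right _ _
  have hem : m * e ≤ ε := by
    have : e ≤ ε / m := min_le_left _ _
    rw [le_div_iff₀ hm] at this; linarith
  set K := 5 + 36 / e with hK
  have hKe : K * e = 5 * e + 36 := by rw [hK]; field_simp
  have hK5 : 5 ≤ K := by rw [hK]; have : 0 < 36 / e := by positivity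
                         linarith
  have hK1 : 2 * K + 2 ≤ e * ((K - 2) ^ 2 / 9) := by
    have : e * (K - 2) ^ 2 = (K * e - 2 * e) * (K - 2) := by ring
    have h2 : e * ((K - 2) ^ 2 / 9) = (K * e - 2 * e) * (K - 2) / 9 := by rw [← this]; ring
    rw [h2, hKe]
    nlinarith
  have hK2 : 3 ≤ e * (K - 1) := by nlinarith
  have hα1 : α < 1 := by linarith
  have hα0 : 0 < α := by linarith
  set d := (1 - σ) * β + σ * α with hd
  have hd0 : 0 ≤ d := by
    have : 0 ≤ 1 - σ := by linarith
    positivity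
  have hd1 : d ≤ 1 := by
    have h1 : (1 - σ) * β ≤ (1 - σ) * 1 :=
      mul_le_mul_of_nonneg_left (by linarith) (by linarith)
    have h2 : σ * α ≤ σ * 1 := mul_le_mul_of_nonneg_left (by linarith) hσ0
    linarith
  set D := m + 2 / lam with hD
  have hD0 : 0 < D := by positivity
  set C1 := 4 * K ^ 2 / lam + (3 * K + 1) * D ^ 2 with hC1
  have hC10 : 0 < C1 := by positivity
  set C2 := C1 + 3 * m * (2 * K ^ 2) + 2 * K ^ 3 with hC2
  have hC20 : 0 < C2 := by positivity
  refine ⟨K, min (min (1 / 4) (1 / D)) (m / C2), hK5, by positivity,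
    (min_le_left _ _).trans ((min_le_left _ _).trans (by norm_num)), ?_⟩
  intro p x hp0 hp hx0 hxK
  have hp4 : p ≤ 1 / 4 := hp.trans ((min_le_left _ _).trans (min_le_left _ _))
  have hpD : p * D ≤ 1 := by
    rw [← le_div_iff₀ hD0]; exact hp.trans ((min_le_left _ _).trans (min_le_right _ _))
  have hpC : p * C2 ≤ m := by
    rw [← le_div_iff₀ hC20]; exact hp.trans (min_le_right _ _)
  have hpα : p * α ≤ p := mul_le_of_le_one_right hp0 hα1.le
  have hpβ : p * β ≤ p := mul_le_of_le_one_right hp0 (by linarith)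
  have hpα0 : 0 ≤ p * α := by positivity
  have hpβ0 : 0 ≤ p * β := by positivity
  obtain ⟨la1, la2⟩ := log_one_sub_bounds hpα0 (by linarith)
  obtain ⟨lb1, lb2⟩ := log_one_sub_bounds hpβ0 (by linarith)
  have hsa : (p * α) ^ 2 ≤ p ^ 2 := by gcongr
  have hsb : (p * β) ^ 2 ≤ p ^ 2 := by gcongr
  set δ := Real.log ((1 - p * β) / (1 - p * α)) / lam with hδ
  have hδl : δ * lam = Real.log (1 - p * β) - Real.log (1 - p * α) := by
    rw [hδ, Real.log_div (by linarith) (by linarith)]; field_simp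
  have hδ1 : δ ≤ m * p + 2 / lam * p ^ 2 := by
    have : δ * lam ≤ (m * p + 2 / lam * p ^ 2) * lam := by
      have : (m * p + 2 / lam * p ^ 2) * lam = m * lam * p + 2 * p ^ 2 := by field_simp
      rw [this, hml, hδl]; linarith
    exact le_of_mul_le_mul_right this hlam
  have hδ2 : m * p - 2 / lam * p ^ 2 ≤ δ := by
    have : (m * p - 2 / lam * p ^ 2) * lam ≤ δ * lam := by
      have : (m * p - 2 / lam * p ^ 2) * lam = m * lam * p - 2 * p ^ 2 := by field_simp
      rw [this, hml, hδl]; linarith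
    exact le_of_mul_le_mul_right this hlam
  have hδ0 : 0 ≤ δ := by
    rw [hδ]
    apply div_nonneg _ hlam.le
    apply Real.log_nonneg
    rw [one_le_div (by linarith)]
    have := mul_le_mul_of_nonneg_left hlt.le hp0
    linarith
  have hδD : δ ≤ D * p := by
    have h1 : p ^ 2 ≤ p := by rw [sq]; exact mul_le_of_le_one_right hp0 (by linarith)
    have h2 : 2 / lam * p ^ 2 ≤ 2 / lam * p := by gcongr
    rw [hD]; linarith
  have hδD2 : δ ^ 2 ≤ D ^ 2 * p ^ 2 := by
    rw [← mul_pow]; gcongr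
  have hδ1' : δ ≤ 1 := by linarith
  have hfx : bump K x = x * (K - x) ^ 2 := by unfold bump; rw [if_pos ⟨hx0, hxK⟩]
  -- derivative bound
  set f' := (K - x) * (K - 3 * x) with hf'
  have hf1 : f' ≤ 2 * K ^ 2 := fprime_le K x hx0 hxK
  have hf2 : -(2 * K ^ 2) ≤ f' := fprime_ge K x hx0 hxK
  -- lower bound for shifted bump
  have hG : x * (K - x) ^ 2 + m * p * f' - C1 * p ^ 2 ≤ bump K (x + δ) := by
    have h1 : (x + δ) * (K - (x + δ)) ^ 2 - (K + 1) * δ ^ 2 ≤ bump K (x + δ) := by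
      unfold bump
      split_ifs with h
      · have : 0 ≤ (K + 1) * δ ^ 2 := by positivity
        linarith
      · have h2 : K < x + δ := by
          by_contra h3
          exact h ⟨by linarith, by linarith⟩
        have h3 : (K - (x + δ)) ^ 2 ≤ δ ^ 2 := by
          rw [← neg_sq]
          apply pow_le_pow_left₀ <;> linarith
        have h4 : (x + δ) * (K - (x + δ)) ^ 2 ≤ (K + 1) * δ ^ 2 := by
          apply mul_le_mul (by linarith) h3 (by positivity) (by linarith)
        linarith
    refine le_trans ?_ h1
    have h5 : (x + δ) * (K - (x + δ)) ^ 2 =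
      x * (K - x) ^ 2 + δ * f' + δ ^ 2 * (3 * x - 2 * K) + δ ^ 3 := by rw [hf']; ring
    have h6 : m * p * f' - 4 * K ^ 2 / lam * p ^ 2 ≤ δ * f' := by
      have h7 : |δ - m * p| ≤ 2 / lam * p ^ 2 := by
        rw [abs_le]; constructor <;> linarith
      have h8 : |f'| ≤ 2 * K ^ 2 := abs_le.mpr ⟨hf2, hf1⟩
      have h9 : |(δ - m * p) * f'| ≤ 2 / lam * p ^ 2 * (2 * K ^ 2) := by
        rw [abs_mul]; gcongr
      have h10 := (abs_le.mp h9).1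
      have h11 : 2 / lam * p ^ 2 * (2 * K ^ 2) = 4 * K ^ 2 / lam * p ^ 2 := by ring
      rw [h11] at h10
      linarith
    have h12 : 0 ≤ δ ^ 3 := by positivity
    have h13 : -(2 * K) * δ ^ 2 ≤ δ ^ 2 * (3 * x - 2 * K) := by
      have : 0 ≤ δ ^ 2 * (3 * x) := by positivity
      linarith
    have h14 : (3 * K + 1) * δ ^ 2 ≤ (3 * K + 1) * (D ^ 2 * p ^ 2) := by gcongr
    rw [hC1]; linarith
  have hA : 1 - d * p - 2 * p ^ 2 ≤ (1 - p * β) ^ (1 - σ) * (1 - p * α) ^ σ := by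
    rw [Real.rpow_def_of_pos (by linarith), Real.rpow_def_of_pos (by linarith), ← Real.exp_add]
    refine le_trans ?_ (Real.add_one_le_exp _)
    have h1 : (1 - σ) * (-(p * β) - 2 * p ^ 2) ≤ (1 - σ) * Real.log (1 - p * β) := by
      apply mul_le_mul_of_nonneg_left _ (by linarith)
      linarith
    have h2 : σ * (-(p * α) - 2 * p ^ 2) ≤ σ * Real.log (1 - p * α) := by
      apply mul_le_mul_of_nonneg_left _ hσ0
      linarith
    rw [hd]; linarith
  have hA0 : 0 ≤ 1 - d * p - 2 * p ^ 2 := by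
    have h1 : d * p ≤ p := mul_le_of_le_one_left hp0 hd1
    have h2 : p ^ 2 ≤ p := by rw [sq]; exact mul_le_of_le_one_right hp0 (by linarith)
    linarith
  have hAF : (1 - d * p - 2 * p ^ 2) * (x * (K - x) ^ 2 + m * p * f' - C1 * p ^ 2)
      ≤ (1 - p * β) ^ (1 - σ) * (1 - p * α) ^ σ * bump K (x + δ) :=
    (mul_le_mul_of_nonneg_left hG hA0).trans (mul_le_mul_of_nonneg_right hA (bump_nonneg _ _))
  have hbr := bracket e K x he0 he1 hK5 hK1 hK2 hx0 hxK
  rw [← hf'] at hbr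
  set f := x * (K - x) ^ 2 with hf
  have hf0 : 0 ≤ f := by positivity
  have hfK : f ≤ K ^ 3 := by rw [← hfx]; exact bump_le _ _ (by linarith)
  rw [hfx]
  refine le_trans ?_ (add_le_add_right hAF _)
  have hexpand : (1 - d * p - 2 * p ^ 2) * (f + m * p * f' - C1 * p ^ 2) =
      f - d * p * f + m * p * f' - p ^ 2 * (2 * f + (d + 2 * p) * m * f' +
        (1 - d * p - 2 * p ^ 2) * C1) := by ring
  have hrem : 2 * f + (d + 2 * p) * m * f' + (1 - d * p - 2 * p ^ 2) * C1 ≤ C2 := by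
    have h1 : (d + 2 * p) * m * f' ≤ 3 * m * (2 * K ^ 2) := by
      have h2 : (d + 2 * p) * m * f' ≤ (d + 2 * p) * m * (2 * K ^ 2) := by gcongr
      have h3 : (d + 2 * p) * m * (2 * K ^ 2) ≤ 3 * m * (2 * K ^ 2) := by gcongr; linarith
      linarith
    have h2 : (1 - d * p - 2 * p ^ 2) * C1 ≤ 1 * C1 := by
      gcongr
      have : 0 ≤ d * p := by positivity
      have h3 := sq_nonneg p
      linarith
    rw [hC2]; linarith
  have hrem2 : p ^ 2 * (2 * f + (d + 2 * p) * m * f' + (1 - d * p - 2 * p ^ 2) * C1) ≤ p * m := by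
    calc _ ≤ p ^ 2 * C2 := by gcongr
      _ = p * (p * C2) := by ring
      _ ≤ p * m := by gcongr
  have hb2 : p * m * (f + 1) ≤ p * m * (bump K (x - 1) + f' + e * f) := by gcongr
  have hb3 : p * f * (m * e) ≤ p * f * ε := by gcongr
  have hγ' : γ = d - m := hγ
  rw [hexpand, hγ']
  linarith

/-! ### Deterministic dynamics of the pair of joint likelihoods -/

/-- signal probabilities -/
def sg (α β : ℝ) (i x : ℕ) : ℝ := if x = i then α else β

/-- MAP estimate as a function of the joint likelihoods and the signal -/
def Mest (α β : ℝ) (w : ℝ × ℝ) (x : ℕ) : ℕ :=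
  if w.2 * sg α β 2 x < w.1 * sg α β 1 x then 1
  else if w.1 * sg α β 1 x < w.2 * sg α β 2 x then 2 else x

/-- probability of action `z` given state `i` and public likelihoods `w` -/
def kern (α β p : ℝ) (w : ℝ × ℝ) (i z : ℕ) : ℝ :=
  p * sg α β i z + (1 - p) * (sg α β i 1 * (if Mest α β w 1 = z then 1 else 0) +
    sg α β i 2 * (if Mest α β w 2 = z then 1 else 0))

/-- update of the joint likelihoods -/
def nxt (α β p : ℝ) (w : ℝ × ℝ) (z : ℕ) : ℝ × ℝ :=
  (w.1 * kern α β p w 1 z, w.2 * kern α β p w 2 z)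

/-- one-step operator -/
def stepOp (α β p : ℝ) (φ : ℝ × ℝ → ℝ) (w : ℝ × ℝ) : ℝ :=
  φ (nxt α β p w 1) + φ (nxt α β p w 2)

/-- sum of `φ` over all histories of length `t` -/
def hsum (α β : ℝ) (p : ℕ → ℝ) : ℕ → (ℝ × ℝ → ℝ) → ℝ
  | 0, φ => φ (1 / 2, 1 / 2)
  | t + 1, φ => hsum α β p t (stepOp α β (p (t + 1)) φ)

/-- admissible likelihood pairs -/
def Adm (w : ℝ × ℝ) : Prop := (0 < w.1 ∧ 0 < w.2) ∨ w = (0, 0)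

section Dyn
variable {α β : ℝ}

theorem kern_nonneg (hβ : 0 < β) (hlt : β < α) {p : ℝ} (hp0 : 0 ≤ p) (hp1 : p ≤ 1)
    (w : ℝ × ℝ) (i z : ℕ) : 0 ≤ kern α β p w i z := by
  have h : ∀ i x, 0 ≤ sg α β i x := by intro i x; unfold sg; split_ifs <;> linarith
  have h1 : 0 ≤ 1 - p := by linarith
  unfold kern
  have := h i z; have := h i 1; have := h i 2
  positivity

theorem kern_comp (hβ : 0 < β) (hlt : β < α) {p : ℝ} (hp0 : 0 ≤ p) (hp1 : p ≤ 1)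
    (w : ℝ × ℝ) (i j z : ℕ) : β * kern α β p w i z ≤ α * kern α β p w j z := by
  have h : ∀ x, β * sg α β i x ≤ α * sg α β j x := by
    intro x; unfold sg; split_ifs <;> nlinarith
  have h1 : 0 ≤ 1 - p := by linarith
  unfold kern
  have h2 : ∀ c : ℝ, 0 ≤ c → ∀ x, c * (β * sg α β i x) ≤ c * (α * sg α β j x) :=
    fun c hc x => mul_le_mul_of_nonneg_left (h x) hc
  have e1 := h2 p hp0 z
  have e2 := h2 ((1 - p) * (if Mest α β w 1 = z then 1 else 0)) (by positivity) 1
  have e3 := h2 ((1 - p) * (if Mest α β w 2 = z then 1 else 0)) (by positivity) 2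
  linarith

theorem Adm_nxt (hβ : 0 < β) (hlt : β < α) {p : ℝ} (hp0 : 0 ≤ p) (hp1 : p ≤ 1)
    {w : ℝ × ℝ} (hw : Adm w) (z : ℕ) : Adm (nxt α β p w z) := by
  rcases hw with ⟨h1, h2⟩ | rfl
  · have k1 := kern_nonneg hβ hlt hp0 hp1 w 1 z
    have k2 := kern_nonneg hβ hlt hp0 hp1 w 2 z
    have c1 := kern_comp hβ hlt hp0 hp1 w 1 2 z
    have c2 := kern_comp hβ hlt hp0 hp1 w 2 1 z
    have hα : 0 < α := by linarith
    rcases k1.eq_or_lt with h | h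
    · have : kern α β p w 2 z = 0 := by
        rw [← h] at c2
        apply le_antisymm _ k2
        by_contra h3
        push Not at h3
        have := mul_pos hβ h3
        linarith
      right; unfold nxt; rw [← h, this]; simp
    · left
      have h3 : 0 < kern α β p w 2 z := by
        by_contra h3
        have h4 : kern α β p w 2 z = 0 := le_antisymm (not_lt.mp h3) k2
        rw [h4] at c1
        have := mul_pos hβ h
        linarith
      exact ⟨mul_pos h1 h, mul_pos h2 h3⟩
  · right; simp [nxt]

theorem hsum_mono (hβ : 0 < β) (hlt : β < α) {p : ℕ → ℝ} (hp : ∀ t, 1 ≤ t → p t ∈ Set.Icc (0:ℝ) 1)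
    (t : ℕ) : ∀ (φ ψ : ℝ × ℝ → ℝ), (∀ w, Adm w → φ w ≤ ψ w) →
      hsum α β p t φ ≤ hsum α β p t ψ := by
  induction t with
  | zero => intro φ ψ h; exact h _ (Or.inl (by norm_num))
  | succ t ih =>
    intro φ ψ h
    apply ih
    intro w hw
    have := hp (t + 1) (by omega)
    exact add_le_add (h _ (Adm_nxt hβ hlt this.1 this.2 hw 1))
      (h _ (Adm_nxt hβ hlt this.1 this.2 hw 2))

theorem hsum_smul (p : ℕ → ℝ) (c : ℝ) (t : ℕ) : ∀ φ : ℝ × ℝ → ℝ,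
    hsum α β p t (fun w => c * φ w) = c * hsum α β p t φ := by
  induction t with
  | zero => intro φ; rfl
  | succ t ih =>
    intro φ
    show hsum α β p t _ = c * hsum α β p t _
    rw [← ih]; congr 1; funext w; simp only [stepOp]; ring

theorem hsum_add (p : ℕ → ℝ) (t : ℕ) : ∀ φ ψ : ℝ × ℝ → ℝ,
    hsum α β p t (fun w => φ w + ψ w) = hsum α β p t φ + hsum α β p t ψ := by
  induction t with
  | zero => intro φ ψ; rfl
  | succ t ih =>
    intro φ ψ
    show hsum α β p t _ = hsum α β p t _ + hsum α β p t _
    rw [← ih]; congr 1; funext w; simp only [stepOp]; ring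

theorem kern_sum (hs : α + β = 1) (p : ℝ) (w : ℝ × ℝ) (i : ℕ) (hi : i = 1 ∨ i = 2) :
    kern α β p w i 1 + kern α β p w i 2 = 1 := by
  have hM : ∀ x, x = 1 ∨ x = 2 → (if Mest α β w x = 1 then (1:ℝ) else 0) +
      (if Mest α β w x = 2 then 1 else 0) = 1 := by
    intro x hx
    unfold Mest
    rcases hx with rfl | rfl <;> split_ifs <;> simp_all
  have h1 := hM 1 (Or.inl rfl)
  have h2 := hM 2 (Or.inr rfl)
  have h3 : sg α β i 1 + sg α β i 2 = 1 := by
    rcases hi with rfl | rfl <;> simp [sg] <;> linarith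
  unfold kern
  calc _ = p * (sg α β i 1 + sg α β i 2) + (1 - p) * (sg α β i 1 *
      ((if Mest α β w 1 = 1 then (1:ℝ) else 0) + (if Mest α β w 1 = 2 then 1 else 0)) +
      sg α β i 2 * ((if Mest α β w 2 = 1 then (1:ℝ) else 0) +
      (if Mest α β w 2 = 2 then 1 else 0))) := by ring
    _ = 1 := by rw [h1, h2, mul_one, mul_one, h3]; ring

theorem hsum_total (hs : α + β = 1) (p : ℕ → ℝ) (t : ℕ) :
    hsum α β p t (fun w => w.1 + w.2) = 1 := by
  induction t with
  | zero => norm_num [hsum]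
  | succ t ih =>
    show hsum α β p t _ = 1
    rw [← ih]; congr 1; funext w
    have h1 := kern_sum hs (p (t+1)) w 1 (Or.inl rfl)
    have h2 := kern_sum hs (p (t+1)) w 2 (Or.inr rfl)
    simp only [stepOp, nxt]
    calc _ = w.1 * (kern α β (p (t+1)) w 1 1 + kern α β (p (t+1)) w 1 2) +
        w.2 * (kern α β (p (t+1)) w 2 1 + kern α β (p (t+1)) w 2 2) := by ring
      _ = _ := by rw [h1, h2]; ring

/-- the error functional -/
def errF (α β p : ℝ) (w : ℝ × ℝ) : ℝ := (nxt α β p w 2).1 + (nxt α β p w 1).2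

theorem errF_eq (p : ℝ) (w : ℝ × ℝ) : errF α β p w =
    p * β * (w.1 + w.2) + (1 - p) * (min (w.1 * α) (w.2 * β) + min (w.1 * β) (w.2 * α)) := by
  have hM1 : w.1 * (α * if Mest α β w 1 = 2 then 1 else 0) +
      w.2 * (β * if Mest α β w 1 = 1 then 1 else 0) = min (w.1 * α) (w.2 * β) := by
    simp only [Mest, sg]
    norm_num
    split_ifs with h1 h2 h3 <;> simp_all [min_def] <;> intros <;> linarith
  have hM2 : w.1 * (β * if Mest α β w 2 = 2 then 1 else 0) +
      w.2 * (α * if Mest α β w 2 = 1 then 1 else 0) = min (w.1 * β) (w.2 * α) := by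
    simp only [Mest, sg]
    norm_num
    split_ifs with h1 h2 h3 <;> simp_all [min_def] <;> intros <;> linarith
  rw [← hM1, ← hM2]
  have e1 : sg α β 1 1 = α := by simp [sg]
  have e2 : sg α β 1 2 = β := by simp [sg]
  have e3 : sg α β 2 1 = β := by simp [sg]
  have e4 : sg α β 2 2 = α := by simp [sg]
  simp only [errF, nxt, kern, e1, e2, e3, e4]
  ring

theorem errF_le (hβ : 0 < β) (hlt : β < α) (hs : α + β = 1) {p : ℝ} (hp0 : 0 ≤ p) (hp1 : p ≤ 1)
    (w : ℝ × ℝ) (hw : Adm w) : errF α β p w ≤ p * β * (w.1 + w.2) + min w.1 w.2 := by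
  rw [errF_eq]
  have hw1 : 0 ≤ w.1 ∧ 0 ≤ w.2 := by
    rcases hw with h | rfl
    · exact ⟨h.1.le, h.2.le⟩
    · simp
  have h1 : min (w.1 * α) (w.2 * β) + min (w.1 * β) (w.2 * α) ≤ min w.1 w.2 := by
    apply le_min
    · have := min_le_left (w.1 * α) (w.2 * β)
      have := min_le_left (w.1 * β) (w.2 * α)
      have : w.1 * (α + β) = w.1 := by rw [hs, mul_one]
      linarith
    · have := min_le_right (w.1 * α) (w.2 * β)
      have := min_le_right (w.1 * β) (w.2 * α)
      have : w.2 * (α + β) = w.2 := by rw [hs, mul_one]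
      linarith
  have h0 : 0 ≤ min w.1 w.2 := le_min hw1.1 hw1.2
  have h2 := mul_le_mul_of_nonneg_left h1 (show 0 ≤ 1 - p by linarith)
  have h3 : (1 - p) * min w.1 w.2 ≤ 1 * min w.1 w.2 := by gcongr; linarith
  linarith

theorem errF_ge (hβ : 0 < β) (hlt : β < α) {p : ℝ} (hp1 : p ≤ 1)
    (w : ℝ × ℝ) (hw : Adm w) :
    p * β * (w.1 + w.2) + (1 - p) * β * min w.1 w.2 ≤ errF α β p w := by
  rw [errF_eq]
  have hw1 : 0 ≤ w.1 ∧ 0 ≤ w.2 := by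
    rcases hw with h | rfl
    · exact ⟨h.1.le, h.2.le⟩
    · simp
  have h0 : 0 ≤ min w.1 w.2 := le_min hw1.1 hw1.2
  have hα : 0 < α := by linarith
  have h1 : β * min w.1 w.2 ≤ min (w.1 * α) (w.2 * β) := by
    apply le_min
    · have := min_le_left w.1 w.2
      nlinarith
    · have := min_le_right w.1 w.2
      nlinarith
  have h2 : 0 ≤ min (w.1 * β) (w.2 * α) :=
    le_min (mul_nonneg hw1.1 hβ.le) (mul_nonneg hw1.2 hα.le)
  have h3 := mul_le_mul_of_nonneg_left (show β * min w.1 w.2 ≤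
    min (w.1 * α) (w.2 * β) + min (w.1 * β) (w.2 * α) by linarith) (show 0 ≤ 1 - p by linarith)
  linarith

theorem hsum_err_le (hβ : 0 < β) (hlt : β < α) (hs : α + β = 1) {p : ℕ → ℝ}
    (hp : ∀ t, 1 ≤ t → p t ∈ Set.Icc (0:ℝ) 1) (t : ℕ) :
    hsum α β p t (errF α β (p (t+1))) ≤
      p (t+1) * β + hsum α β p t (fun w => min w.1 w.2) := by
  have h := hp (t+1) (by omega)
  refine (hsum_mono hβ hlt hp t _ _ (errF_le hβ hlt hs h.1 h.2)).trans ?_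
  rw [hsum_add, hsum_smul p (p (t+1) * β) t (fun w => w.1 + w.2), hsum_total hs, mul_one]

theorem hsum_err_ge (hβ : 0 < β) (hlt : β < α) (hs : α + β = 1) {p : ℕ → ℝ}
    (hp : ∀ t, 1 ≤ t → p t ∈ Set.Icc (0:ℝ) 1) (t : ℕ) :
      p (t+1) * β + (1 - p (t+1)) * β * hsum α β p t (fun w => min w.1 w.2) ≤
    hsum α β p t (errF α β (p (t+1))) := by
  have h := hp (t+1) (by omega)
  refine le_trans ?_ (hsum_mono hβ hlt hp t _ _ (errF_ge hβ hlt h.2))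
  rw [hsum_add, hsum_smul p (p (t+1) * β) t (fun w => w.1 + w.2), hsum_total hs, mul_one,
    hsum_smul p ((1 - p (t+1)) * β) t (fun w => min w.1 w.2)]

/-- herding on 1 -/
theorem nxt_herd1 (hβ : 0 < β) (hlt : β < α) (hs : α + β = 1) (p : ℝ) (w : ℝ × ℝ)
    (h2 : 0 < w.2) (h : w.2 * α < w.1 * β) :
    nxt α β p w 1 = (w.1 * (1 - p * β), w.2 * (1 - p * α)) ∧
    nxt α β p w 2 = (w.1 * (p * β), w.2 * (p * α)) := by
  have h1 : 0 < w.1 := by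
    by_contra h3
    have : 0 < w.2 * α := mul_pos h2 (by linarith)
    nlinarith
  have hM1 : Mest α β w 1 = 1 := by
    simp only [Mest, sg]
    norm_num
    intro h5; nlinarith
  have hM2 : Mest α β w 2 = 1 := by
    simp only [Mest, sg]
    norm_num [h]
  have hα : α = 1 - β := by linarith
  simp only [nxt, kern, hM1, hM2, sg]
  norm_num
  rw [hα]
  exact ⟨Or.inl (by ring), Or.inl (by ring)⟩

/-- herding on 2 -/
theorem nxt_herd2 (hβ : 0 < β) (hlt : β < α) (hs : α + β = 1) (p : ℝ) (w : ℝ × ℝ)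
    (h2 : 0 < w.1) (h : w.1 * α < w.2 * β) :
    nxt α β p w 2 = (w.1 * (1 - p * α), w.2 * (1 - p * β)) ∧
    nxt α β p w 1 = (w.1 * (p * α), w.2 * (p * β)) := by
  have h1 : 0 < w.2 := by
    by_contra h3
    have : 0 < w.1 * α := mul_pos h2 (by linarith)
    nlinarith
  have h6 : w.1 * β < w.2 * α := by nlinarith
  have hM1 : Mest α β w 1 = 2 := by
    simp only [Mest, sg]
    norm_num [h, h.le]
  have hM2 : Mest α β w 2 = 2 := by
    simp only [Mest, sg]
    norm_num [h6.le]
  have hα : α = 1 - β := by linarith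
  simp only [nxt, kern, hM1, hM2, sg]
  norm_num
  rw [hα]
  exact ⟨Or.inl (by ring), Or.inl (by ring)⟩

/-- no herding -/
theorem nxt_mid (hβ : 0 < β) (hlt : β < α) (hs : α + β = 1) (p : ℝ) (w : ℝ × ℝ)
    (h1 : w.1 * β ≤ w.2 * α) (h2 : w.2 * β ≤ w.1 * α) :
    nxt α β p w 1 = (w.1 * α, w.2 * β) ∧ nxt α β p w 2 = (w.1 * β, w.2 * α) := by
  have hM1 : Mest α β w 1 = 1 := by
    simp only [Mest, sg]
    norm_num
    intro h3; linarith
  have hM2 : Mest α β w 2 = 2 := by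
    simp only [Mest, sg]
    norm_num [h1]
  simp only [nxt, kern, hM1, hM2, sg]
  norm_num
  refine ⟨⟨?_, ?_⟩, ?_, ?_⟩ <;> ring_nf <;> simp

end Dyn

/-! ### Two elementary lemmas on sequences -/

/-- harmonic sums -/
def harm (n : ℕ) : ℝ := ∑ i ∈ Finset.range n, 1 / ((i : ℝ) + 1)

theorem harm_tendsto : Tendsto harm atTop atTop :=
  Real.tendsto_sum_range_one_div_nat_succ_atTop

theorem harm_succ (n : ℕ) : harm (n + 1) = harm n + 1 / ((n : ℝ) + 1) := by
  unfold harm; rw [Finset.sum_range_succ]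

theorem seq_to_zero (r : ℕ → ℝ) (η : ℝ) (hη : 0 < η) (T : ℕ) (hr : ∀ t, 0 ≤ r t)
    (h : ∀ t, T ≤ t → r (t + 1) ≤ (1 - η / ((t : ℝ) + 1)) * r t) :
    Tendsto r atTop (nhds 0) := by
  have key : ∀ t, T ≤ t → r t ≤ r T * Real.exp (-(η * (harm t - harm T))) := by
    intro t ht
    induction t, ht using Nat.le_induction with
    | base => simp
    | succ t ht ih =>
      have h1 : 1 - η / ((t : ℝ) + 1) ≤ Real.exp (-(η / ((t : ℝ) + 1))) := by
        have := Real.add_one_le_exp (-(η / ((t : ℝ) + 1))); linarith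
      calc r (t + 1) ≤ (1 - η / ((t : ℝ) + 1)) * r t := h t ht
        _ ≤ Real.exp (-(η / ((t : ℝ) + 1))) * r t := by gcongr; exact hr t
        _ ≤ Real.exp (-(η / ((t : ℝ) + 1))) * (r T * Real.exp (-(η * (harm t - harm T)))) := by
            gcongr
        _ = r T * Real.exp (-(η * (harm (t + 1) - harm T))) := by
            rw [mul_left_comm, ← Real.exp_add, harm_succ]; congr 2; ring
  have hlim : Tendsto (fun t => r T * Real.exp (-(η * (harm t - harm T)))) atTop (nhds 0) := by
    have h1 : Tendsto (fun t => η * (harm t - harm T)) atTop atTop :=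
      Tendsto.const_mul_atTop hη (tendsto_atTop_add_const_right _ _ harm_tendsto)
    have h2 := (Real.tendsto_exp_neg_atTop_nhds_zero.comp h1).const_mul (r T)
    simpa using h2
  refine squeeze_zero' (Eventually.of_forall hr) ?_ hlim
  filter_upwards [eventually_ge_atTop T] with t ht using key t ht

theorem seq_unbounded (r : ℕ → ℝ) (η : ℝ) (hη : 0 < η) (T : ℕ) (hr : 0 < r T)
    (h : ∀ t, T ≤ t → (1 + η / ((t : ℝ) + 1)) * r t ≤ r (t + 1)) (M : ℝ) :
    ∃ t, T ≤ t ∧ M < r t := by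
  have key : ∀ t, T ≤ t → r T ≤ r t ∧ r T * (1 + η * (harm t - harm T)) ≤ r t := by
    intro t ht
    induction t, ht using Nat.le_induction with
    | base => simp
    | succ t ht ih =>
      have h0 := h t ht
      have h1 : η / ((t : ℝ) + 1) * r T ≤ η / ((t : ℝ) + 1) * r t := by
        gcongr; exact ih.1
      have h2 : 0 ≤ η / ((t : ℝ) + 1) * r T := by positivity
      refine ⟨by linarith [ih.1], ?_⟩
      rw [harm_succ]
      have : r T * (1 + η * (harm t + 1 / ((t : ℝ) + 1) - harm T)) =
        r T * (1 + η * (harm t - harm T)) + η / ((t : ℝ) + 1) * r T := by ring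
      rw [this]; linarith [ih.2]
  have hlim : Tendsto (fun t => r T * (1 + η * (harm t - harm T))) atTop atTop :=
    Tendsto.const_mul_atTop hr (tendsto_atTop_add_const_left _ _
      (Tendsto.const_mul_atTop hη (tendsto_atTop_add_const_right _ _ harm_tendsto)))
  obtain ⟨t, ht1, ht2⟩ := ((hlim.eventually_gt_atTop M).and (eventually_ge_atTop T)).exists
  exact ⟨t, ht2, ht1.trans_le (key t ht2).2⟩

/-! ### Potential functions -/

/-- weighted geometric mean -/
def gm (σ x y : ℝ) : ℝ := x ^ (1 - σ) * y ^ σ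

/-- potential for the upper bound -/
def Vpot (σ : ℝ) (w : ℝ × ℝ) : ℝ := min (gm σ w.1 w.2) (gm σ w.2 w.1)

theorem gm_mul (σ : ℝ) {x y k l : ℝ} (hx : 0 ≤ x) (hy : 0 ≤ y) (hk : 0 ≤ k) (hl : 0 ≤ l) :
    gm σ (x * k) (y * l) = gm σ x y * gm σ k l := by
  unfold gm; rw [Real.mul_rpow hx hk, Real.mul_rpow hy hl]; ring

theorem gm_nonneg (σ : ℝ) {x y : ℝ} (hx : 0 ≤ x) (hy : 0 ≤ y) : 0 ≤ gm σ x y := by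
  unfold gm; positivity

theorem gm_self (σ : ℝ) {x : ℝ} (hx : 0 < x) : gm σ x x = x := by
  unfold gm; rw [← Real.rpow_add hx]; simp

theorem gm_mono {σ : ℝ} (h0 : 0 ≤ σ) (h1 : σ ≤ 1) {x y x' y' : ℝ} (hx : 0 ≤ x) (hy : 0 ≤ y)
    (hxx : x ≤ x') (hyy : y ≤ y') : gm σ x y ≤ gm σ x' y' := by
  unfold gm
  have : 0 ≤ 1 - σ := by linarith
  gcongr
  exact Real.rpow_nonneg (hx.trans hxx) _

theorem gm_am {σ : ℝ} (h0 : 0 ≤ σ) (h1 : σ ≤ 1) {x y : ℝ} (hx : 0 ≤ x) (hy : 0 ≤ y) :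
    gm σ x y ≤ (1 - σ) * x + σ * y :=
  Real.geom_mean_le_arith_mean2_weighted (by linarith) h0 hx hy (by ring)

theorem gm_swap_le {σ : ℝ} (h0 : 1 / 2 ≤ σ) {x y : ℝ} (hy : 0 < y) (hyx : y ≤ x) :
    gm σ x y ≤ gm σ y x := by
  have hx : 0 < x := hy.trans_le hyx
  unfold gm
  have e1 : y ^ σ = y ^ (1 - σ) * y ^ (2 * σ - 1) := by rw [← Real.rpow_add hy]; ring_nf
  have e2 : x ^ σ = x ^ (1 - σ) * x ^ (2 * σ - 1) := by rw [← Real.rpow_add hx]; ring_nf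
  have h : y ^ (2 * σ - 1) ≤ x ^ (2 * σ - 1) :=
    Real.rpow_le_rpow hy.le hyx (by linarith)
  rw [e1, e2]
  calc x ^ (1 - σ) * (y ^ (1 - σ) * y ^ (2 * σ - 1))
      ≤ x ^ (1 - σ) * (y ^ (1 - σ) * x ^ (2 * σ - 1)) := by gcongr
    _ = _ := by ring

theorem min_le_Vpot {σ : ℝ} (h0 : 0 ≤ σ) (h1 : σ ≤ 1) {w : ℝ × ℝ} (hw : Adm w) :
    min w.1 w.2 ≤ Vpot σ w := by
  rcases hw with ⟨h, h'⟩ | rfl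
  · have hm : 0 < min w.1 w.2 := lt_min h h'
    have e := gm_self σ hm
    refine le_min ?_ ?_
    · calc _ = _ := e.symm
        _ ≤ _ := gm_mono h0 h1 hm.le hm.le (min_le_left _ _) (min_le_right _ _)
    · calc _ = _ := e.symm
        _ ≤ _ := gm_mono h0 h1 hm.le hm.le (min_le_right _ _) (min_le_left _ _)
  · simp [Vpot, gm]; positivity

theorem Vpot_step {α β m σ γ : ℝ} (hβ : 0 < β) (hlt : β < α) (hs : α + β = 1)
    (hm : m = β ^ (1 - σ) * α ^ σ) (hσ0 : 1 / 2 ≤ σ) (hσ1 : σ ≤ 1)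
    (hγ : γ = (1 - σ) * β + σ * α - m) (hγ0 : 0 < γ) {p : ℝ} (hp0 : 0 ≤ p) (hp1 : p ≤ 1)
    {w : ℝ × ℝ} (hw : Adm w) : stepOp α β p (Vpot σ) w ≤ (1 - γ * p) * Vpot σ w := by
  have hα : 0 < α := by linarith
  have hσ : 0 ≤ σ := by linarith
  have hpα : p * α ≤ 1 := by nlinarith
  have hpβ : p * β ≤ 1 := by nlinarith
  have hpα0 : 0 ≤ p * α := by positivity
  have hpβ0 : 0 ≤ p * β := by positivity
  have hm' : gm σ β α = m := hm.symm
  have hmp : gm σ (p * β) (p * α) = p * m := by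
    rw [gm_mul σ hp0 hp0 hβ.le hα.le, hm']
    rcases hp0.eq_or_lt with h | h
    · rw [← h]; unfold gm; rw [Real.zero_rpow (show σ ≠ 0 by linarith)]; ring
    · rw [gm_self σ h]
  -- herding factor
  have fH : gm σ (1 - p * β) (1 - p * α) + gm σ (p * β) (p * α) ≤ 1 - γ * p := by
    have := gm_am hσ hσ1 (show 0 ≤ 1 - p * β by linarith) (show 0 ≤ 1 - p * α by linarith)
    rw [hmp, hγ]; linarith
  have fM : gm σ α β + gm σ β α ≤ 1 - γ * p := by
    have h1 := gm_am hσ hσ1 hα.le hβ.le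
    have h2 : γ * p ≤ γ := mul_le_of_le_one_right hγ0.le hp1
    rw [hm', hγ] at *
    have : (1 - σ) * α + σ * β = 1 - ((1 - σ) * β + σ * α) := by
      linear_combination hs
    linarith
  have expand : ∀ x y : ℝ, 0 < x → 0 < y → ∀ k l k' l' : ℝ, 0 ≤ k → 0 ≤ l → 0 ≤ k' → 0 ≤ l' →
      gm σ k l + gm σ k' l' ≤ 1 - γ * p →
      gm σ (x * k) (y * l) + gm σ (x * k') (y * l') ≤ (1 - γ * p) * gm σ x y := by
    intro x y hx hy k l k' l' hk hl hk' hl' hle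
    rw [gm_mul σ hx.le hy.le hk hl, gm_mul σ hx.le hy.le hk' hl', ← mul_add, mul_comm]
    exact mul_le_mul_of_nonneg_right hle (gm_nonneg σ hx.le hy.le)
  rcases hw with ⟨h1, h2⟩ | rfl
  · rcases le_total w.2 w.1 with hc | hc
    · have hV : Vpot σ w = gm σ w.1 w.2 := min_eq_left (gm_swap_le hσ0 h2 hc)
      have hle : stepOp α β p (Vpot σ) w ≤ gm σ (nxt α β p w 1).1 (nxt α β p w 1).2 +
        gm σ (nxt α β p w 2).1 (nxt α β p w 2).2 :=
        add_le_add (min_le_left _ _) (min_le_left _ _)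
      refine hle.trans ?_
      rw [hV]
      rcases lt_or_ge (w.2 * α) (w.1 * β) with hh | hh
      · obtain ⟨e1, e2⟩ := nxt_herd1 hβ hlt hs p w h2 hh
        rw [e1, e2]
        exact expand _ _ h1 h2 _ _ _ _ (by linarith) (by linarith) hpβ0 hpα0 fH
      · obtain ⟨e1, e2⟩ := nxt_mid hβ hlt hs p w hh (by nlinarith)
        rw [e1, e2]
        exact expand _ _ h1 h2 _ _ _ _ hα.le hβ.le hβ.le hα.le fM
    · have hV : Vpot σ w = gm σ w.2 w.1 := min_eq_right (gm_swap_le hσ0 h1 hc)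
      have hle : stepOp α β p (Vpot σ) w ≤ gm σ (nxt α β p w 2).2 (nxt α β p w 2).1 +
        gm σ (nxt α β p w 1).2 (nxt α β p w 1).1 := by
        rw [add_comm]
        exact add_le_add (min_le_right _ _) (min_le_right _ _)
      refine hle.trans ?_
      rw [hV]
      rcases lt_or_ge (w.1 * α) (w.2 * β) with hh | hh
      · obtain ⟨e1, e2⟩ := nxt_herd2 hβ hlt hs p w h1 hh
        rw [e1, e2]
        exact expand _ _ h2 h1 _ _ _ _ (by linarith) (by linarith) hpβ0 hpα0 fH
      · obtain ⟨e1, e2⟩ := nxt_mid hβ hlt hs p w (by nlinarith) hh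
        rw [e1, e2]
        exact expand _ _ h2 h1 _ _ _ _ hα.le hβ.le hβ.le hα.le fM
  · have h0 : Vpot σ (0, 0) = 0 := by
      simp [Vpot, gm, Real.zero_rpow (show σ ≠ 0 by linarith)]
    have h1 : ∀ z, nxt α β p (0, 0) z = (0, 0) := by intro z; simp [nxt]
    simp [stepOp, h1, h0]

/-- potential for the lower bound -/
def Wpot (σ lam K : ℝ) (w : ℝ × ℝ) : ℝ :=
  gm σ w.1 w.2 * bump K (Real.log (w.1 / w.2) / lam - 1)

theorem Wpot_nonneg (σ lam K : ℝ) {w : ℝ × ℝ} (hw : Adm w) : 0 ≤ Wpot σ lam K w := by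
  refine mul_nonneg (gm_nonneg σ ?_ ?_) (bump_nonneg _ _)
  · rcases hw with h | rfl
    · exact h.1.le
    · exact le_rfl
  · rcases hw with h | rfl
    · exact h.2.le
    · exact le_rfl

theorem bump_support {α β lam K : ℝ} (hβ : 0 < β) (hlt : β < α) (hlam : 0 < lam)
    (hl : lam = Real.log (α / β)) {w : ℝ × ℝ} (h1 : 0 < w.1) (h2 : 0 < w.2)
    (h : bump K (Real.log (w.1 / w.2) / lam - 1) ≠ 0) :
    (0 ≤ Real.log (w.1 / w.2) / lam - 1 ∧ Real.log (w.1 / w.2) / lam - 1 ≤ K) ∧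
      w.2 * α < w.1 * β := by
  have hα : 0 < α := by linarith
  unfold bump at h
  split_ifs at h with hx
  · refine ⟨hx, ?_⟩
    have hx0 : 0 < Real.log (w.1 / w.2) / lam - 1 := lt_of_le_of_ne hx.1 (by
      intro h3; rw [← h3] at h; simp at h)
    have h3 : lam < Real.log (w.1 / w.2) := by
      have : 1 < Real.log (w.1 / w.2) / lam := by linarith
      rwa [one_lt_div hlam] at this
    rw [hl] at h3
    have h4 := (Real.log_lt_log_iff (by positivity) (by positivity)).mp h3
    rw [div_lt_div_iff₀ hβ h2] at h4
    linarith
  · exact absurd rfl h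

theorem Wpot_le_min {α β lam σ K : ℝ} (hβ : 0 < β) (hlt : β < α) (hlam : 0 < lam)
    (hl : lam = Real.log (α / β)) (hσ0 : 0 < σ) (hσ1 : σ ≤ 1) (hK : 0 ≤ K)
    {w : ℝ × ℝ} (hw : Adm w) :
    Wpot σ lam K w ≤ Real.exp (lam * (K + 1)) * K ^ 3 * min w.1 w.2 := by
  rcases hw with ⟨h1, h2⟩ | rfl
  · by_cases hb : bump K (Real.log (w.1 / w.2) / lam - 1) = 0
    · unfold Wpot; rw [hb, mul_zero]
      have : 0 < min w.1 w.2 := lt_min h1 h2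
      positivity
    · obtain ⟨⟨hx0, hxK⟩, hh⟩ := bump_support hβ hlt hlam hl h1 h2 hb
      have h21 : w.2 ≤ w.1 := by nlinarith
      rw [min_eq_right h21]
      have h3 : gm σ w.1 w.2 ≤ w.1 := by
        calc gm σ w.1 w.2 ≤ gm σ w.1 w.1 := gm_mono hσ0.le hσ1 h1.le h2.le le_rfl h21
          _ = w.1 := gm_self σ h1
      have h4 : w.1 / w.2 ≤ Real.exp (lam * (K + 1)) := by
        rw [← Real.log_le_iff_le_exp (by positivity)]
        have : Real.log (w.1 / w.2) / lam ≤ K + 1 := by linarith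
        rw [div_le_iff₀ hlam] at this; linarith
      rw [div_le_iff₀ h2] at h4
      calc Wpot σ lam K w ≤ (Real.exp (lam * (K + 1)) * w.2) * K ^ 3 :=
            mul_le_mul (h3.trans h4) (bump_le _ _ hK) (bump_nonneg _ _) (by positivity)
        _ = _ := by ring
  · simp [Wpot, gm, Real.zero_rpow hσ0.ne']

theorem Wpot_step {α β lam m σ γ ε K p : ℝ} (hβ : 0 < β) (hlt : β < α) (hs : α + β = 1)
    (hlam : 0 < lam) (hl : lam = Real.log (α / β))
    (hm : m = β ^ (1 - σ) * α ^ σ) (hσ0 : 0 < σ)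
    (hp0 : 0 ≤ p) (hp1 : p ≤ 1)
    (hstep : ∀ x : ℝ, 0 ≤ x → x ≤ K →
      (1 - (γ + ε) * p) * bump K x ≤ p * m * bump K (x - 1) +
        (1 - p * β) ^ (1 - σ) * (1 - p * α) ^ σ *
          bump K (x + Real.log ((1 - p * β) / (1 - p * α)) / lam))
    {w : ℝ × ℝ} (hw : Adm w) :
    (1 - (γ + ε) * p) * Wpot σ lam K w ≤ stepOp α β p (Wpot σ lam K) w := by
  have hnn : 0 ≤ stepOp α β p (Wpot σ lam K) w :=
    add_nonneg (Wpot_nonneg _ _ _ (Adm_nxt hβ hlt hp0 hp1 hw 1))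
      (Wpot_nonneg _ _ _ (Adm_nxt hβ hlt hp0 hp1 hw 2))
  have hα : 0 < α := by linarith
  have hpα : p * α < 1 := by nlinarith
  have hpβ : p * β < 1 := by nlinarith
  rcases hw with ⟨h1, h2⟩ | rfl
  · by_cases hb : bump K (Real.log (w.1 / w.2) / lam - 1) = 0
    · have : Wpot σ lam K w = 0 := by unfold Wpot; rw [hb, mul_zero]
      rw [this, mul_zero]; exact hnn
    · obtain ⟨⟨hx0, hxK⟩, hh⟩ := bump_support hβ hlt hlam hl h1 h2 hb
      set x := Real.log (w.1 / w.2) / lam - 1 with hx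
      obtain ⟨e1, e2⟩ := nxt_herd1 hβ hlt hs p w h2 hh
      have hg0 : 0 ≤ gm σ w.1 w.2 := gm_nonneg σ h1.le h2.le
      have w1 : Wpot σ lam K (nxt α β p w 1) = gm σ w.1 w.2 *
          ((1 - p * β) ^ (1 - σ) * (1 - p * α) ^ σ *
          bump K (x + Real.log ((1 - p * β) / (1 - p * α)) / lam)) := by
        rw [e1]
        unfold Wpot
        simp only
        rw [gm_mul σ h1.le h2.le (by linarith) (by linarith), mul_div_mul_comm,
          Real.log_mul (by positivity) (div_pos (by linarith) (by linarith)).ne']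
        rw [show ∀ u v : ℝ, (u + v) / lam - 1 = (u / lam - 1) + v / lam by intros; ring, ← hx]
        unfold gm; ring
      have w2 : gm σ w.1 w.2 * (p * m * bump K (x - 1)) ≤ Wpot σ lam K (nxt α β p w 2) := by
        rcases hp0.eq_or_lt with h | h
        · rw [← h]; simp only [zero_mul, mul_zero]
          exact Wpot_nonneg _ _ _ (Adm_nxt hβ hlt le_rfl zero_le_one (Or.inl ⟨h1, h2⟩) 2)
        · rw [e2]
          unfold Wpot
          simp only
          rw [gm_mul σ h1.le h2.le (by positivity) (by positivity), mul_div_mul_comm,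
            Real.log_mul (by positivity) (by positivity), mul_div_mul_left _ _ h.ne',
            gm_mul σ h.le h.le hβ.le hα.le, gm_self σ h]
          have : Real.log (β / α) = - lam := by
            rw [hl, ← Real.log_inv, inv_div]
          rw [this, show ∀ u : ℝ, (u + -lam) / lam - 1 = (u / lam - 1) - 1 by
            intros; field_simp; ring, ← hx, hm]
          unfold gm; apply le_of_eq; ring
      have := mul_le_mul_of_nonneg_left (hstep x hx0 hxK) hg0
      unfold stepOp
      rw [w1]
      have e3 : Wpot σ lam K w = gm σ w.1 w.2 * bump K x := rfl
      rw [e3]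
      linarith
  · have : Wpot σ lam K (0, 0) = 0 := by simp [Wpot, gm, Real.zero_rpow hσ0.ne']
    rw [this, mul_zero]; exact hnn

/-! ### A path staying in the support -/

theorem path_exists {α β : ℝ} (hβ : 0 < β) (hlt : β < α) (hs : α + β = 1) {p : ℕ → ℝ}
    (hp : ∀ t, 1 ≤ t → p t ∈ Set.Icc (0:ℝ) 1) (t : ℕ) :
    ∃ w : ℝ × ℝ, 0 < w.1 ∧ 0 < w.2 ∧ w.2 * α ^ 2 ≤ w.1 * β ^ 2 ∧ w.1 * β ^ 4 ≤ w.2 * α ^ 4 ∧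
      ∀ φ : ℝ × ℝ → ℝ, (∀ w, Adm w → 0 ≤ φ w) → φ w ≤ hsum α β p (t + 2) φ := by
  have hα : 0 < α := by linarith
  have hα1 : α < 1 := by linarith
  induction t with
  | zero =>
    refine ⟨(α * α / 2, β * β / 2), by positivity, by positivity, ?_, ?_, ?_⟩
    · simp only; apply le_of_eq; ring
    · simp only
      have : β ^ 2 ≤ α ^ 2 := by gcongr
      have h2 : (α ^ 2 * β ^ 2) * β ^ 2 ≤ (α ^ 2 * β ^ 2) * α ^ 2 := by gcongr
      nlinarith
    · intro φ hφ
      have hp1 := hp 1 le_rfl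
      have hp2 := hp 2 (by norm_num)
      have e1 : nxt α β (p 1) (1/2, 1/2) 1 = (1/2 * α, 1/2 * β) :=
        (nxt_mid hβ hlt hs (p 1) (1/2, 1/2) (by simp only; linarith) (by simp only; linarith)).1
      have e2 : nxt α β (p 2) (1/2 * α, 1/2 * β) 1 = (1/2 * α * α, 1/2 * β * β) :=
        (nxt_mid hβ hlt hs (p 2) (1/2 * α, 1/2 * β) (by simp only; linarith)
          (by simp only; nlinarith)).1
      have a0 : Adm (1/2, 1/2) := Or.inl (by norm_num)
      have a1 := Adm_nxt hβ hlt hp1.1 hp1.2 a0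
      have h1 : φ (1/2 * α * α, 1/2 * β * β) ≤ stepOp α β (p 2) φ (1/2 * α, 1/2 * β) := by
        unfold stepOp; rw [e2]
        have := hφ _ (Adm_nxt hβ hlt hp2.1 hp2.2 (e1 ▸ a1 1) 2)
        linarith
      have h2 : stepOp α β (p 2) φ (1/2 * α, 1/2 * β) ≤
          stepOp α β (p 1) (stepOp α β (p 2) φ) (1/2, 1/2) := by
        conv_rhs => unfold stepOp
        rw [e1]
        have : 0 ≤ stepOp α β (p 2) φ (nxt α β (p 1) (1/2, 1/2) 2) :=
          add_nonneg (hφ _ (Adm_nxt hβ hlt hp2.1 hp2.2 (a1 2) 1))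
            (hφ _ (Adm_nxt hβ hlt hp2.1 hp2.2 (a1 2) 2))
        unfold stepOp at this ⊢
        linarith
      have e : ((α * α / 2, β * β / 2) : ℝ × ℝ) = (1/2 * α * α, 1/2 * β * β) := by
        congr 1 <;> ring
      rw [e]
      exact h1.trans h2
  | succ t ih =>
    obtain ⟨w, h1, h2, h3, h4, h5⟩ := ih
    have hq := hp (t + 3) (by omega)
    set q := p (t + 3) with hqdef
    have hherd : w.2 * α < w.1 * β := by
      have : β * (w.2 * α) < β * (w.1 * β) := by
        have : w.2 * α * β < w.2 * α * α := by gcongr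
        nlinarith
      exact lt_of_mul_lt_mul_left this hβ.le
    have hw : Adm w := Or.inl ⟨h1, h2⟩
    obtain ⟨e1, e2⟩ := nxt_herd1 hβ hlt hs q w h2 hherd
    have hgo : ∀ φ : ℝ × ℝ → ℝ, (∀ w, Adm w → 0 ≤ φ w) →
        φ (nxt α β q w 1) ≤ hsum α β p (t + 1 + 2) φ ∧
        φ (nxt α β q w 2) ≤ hsum α β p (t + 1 + 2) φ := by
      intro φ hφ
      have hstep := h5 (stepOp α β q φ) (fun v hv =>
        add_nonneg (hφ _ (Adm_nxt hβ hlt hq.1 hq.2 hv 1)) (hφ _ (Adm_nxt hβ hlt hq.1 hq.2 hv 2)))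
      have a1 := hφ _ (Adm_nxt hβ hlt hq.1 hq.2 hw 1)
      have a2 := hφ _ (Adm_nxt hβ hlt hq.1 hq.2 hw 2)
      have e3 : hsum α β p (t + 1 + 2) φ = hsum α β p (t + 2) (stepOp α β q φ) := rfl
      have e4 : stepOp α β q φ w = φ (nxt α β q w 1) + φ (nxt α β q w 2) := rfl
      rw [e3]
      constructor <;> linarith
    have hqα : q * α < 1 := by nlinarith [hq.1, hq.2]
    have hqβ : q * β < 1 := by nlinarith [hq.1, hq.2]
    have hqle : q * β ≤ q * α := mul_le_mul_of_nonneg_left hlt.le hq.1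
    have hr : (1 - q * β) * β ≤ (1 - q * α) * α := by
      have : q * (α - β) * (α + β) ≤ (α - β) := by
        rw [hs, mul_one]; exact mul_le_of_le_one_left (by linarith) hq.2
      nlinarith
    by_cases hc : w.1 * β ^ 3 ≤ w.2 * α ^ 3
    · refine ⟨nxt α β q w 1, ?_, ?_, ?_, ?_, fun φ hφ => (hgo φ hφ).1⟩ <;> rw [e1] <;> simp only
      · exact mul_pos h1 (by linarith)
      · exact mul_pos h2 (by linarith)
      · calc w.2 * (1 - q * α) * α ^ 2 = (w.2 * α ^ 2) * (1 - q * α) := by ring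
          _ ≤ (w.1 * β ^ 2) * (1 - q * β) := by
            apply mul_le_mul h3 (by linarith) (by linarith) (by positivity)
          _ = _ := by ring
      · calc w.1 * (1 - q * β) * β ^ 4 = (w.1 * β ^ 3) * ((1 - q * β) * β) := by ring
          _ ≤ (w.2 * α ^ 3) * ((1 - q * α) * α) := by
            apply mul_le_mul hc hr (mul_nonneg (by linarith) hβ.le) (by positivity)
          _ = _ := by ring
    · push Not at hc
      rcases hq.1.eq_or_lt with h | h
      · rw [← h] at e1
        refine ⟨nxt α β q w 1, ?_, ?_, ?_, ?_, fun φ hφ => (hgo φ hφ).1⟩ <;> rw [← h, e1] <;>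
          simpa
      · refine ⟨nxt α β q w 2, ?_, ?_, ?_, ?_, fun φ hφ => (hgo φ hφ).2⟩ <;> rw [e2] <;> simp only
        · positivity
        · positivity
        · calc w.2 * (q * α) * α ^ 2 = q * (w.2 * α ^ 3) := by ring
            _ ≤ q * (w.1 * β ^ 3) := by gcongr
            _ = _ := by ring
        · calc w.1 * (q * β) * β ^ 4 = q * (β * (w.1 * β ^ 4)) := by ring
            _ ≤ q * (α * (w.2 * α ^ 4)) := by gcongr
            _ = _ := by ring

theorem Wpot_pos {α β lam σ K : ℝ} (hβ : 0 < β) (hlt : β < α) (hs : α + β = 1)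
    (hlam : 0 < lam) (hl : lam = Real.log (α / β)) (hK : 5 ≤ K) {p : ℕ → ℝ}
    (hp : ∀ t, 1 ≤ t → p t ∈ Set.Icc (0:ℝ) 1) (t : ℕ) :
    0 < hsum α β p (t + 2) (Wpot σ lam K) := by
  obtain ⟨w, h1, h2, h3, h4, h5⟩ := path_exists hβ hlt hs hp t
  refine lt_of_lt_of_le ?_ (h5 _ (fun w hw => Wpot_nonneg _ _ _ hw))
  have hα : 0 < α := by linarith
  have l1 : 2 * lam ≤ Real.log (w.1 / w.2) := by
    have : Real.log ((α / β) ^ 2) ≤ Real.log (w.1 / w.2) := by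
      apply Real.log_le_log (by positivity)
      rw [div_pow, div_le_div_iff₀ (by positivity) h2]; linarith
    rw [Real.log_pow, ← hl] at this; exact_mod_cast this
  have l2 : Real.log (w.1 / w.2) ≤ 4 * lam := by
    have : Real.log (w.1 / w.2) ≤ Real.log ((α / β) ^ 4) := by
      apply Real.log_le_log (by positivity)
      rw [div_pow, div_le_div_iff₀ h2 (by positivity)]; linarith
    rw [Real.log_pow, ← hl] at this; exact_mod_cast this
  rw [← le_div_iff₀ hlam] at l1
  rw [← div_le_iff₀ hlam] at l2
  refine mul_pos (by unfold gm; positivity) ?_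
  unfold bump
  rw [if_pos ⟨by linarith, by linarith⟩]
  apply mul_pos (by linarith)
  apply pow_pos; linarith

/-! ### The two bounds for the deterministic dynamics -/

theorem det_upper {α β m σ γ c : ℝ} (hβ : 0 < β) (hlt : β < α) (hs : α + β = 1)
    (hm : m = β ^ (1 - σ) * α ^ σ) (hσ0 : 1 / 2 ≤ σ) (hσ1 : σ ≤ 1)
    (hγ : γ = (1 - σ) * β + σ * α - m) (hγ0 : 0 < γ) (hc : 1 < γ * c) (hc0 : 0 < c)
    (η : ℝ) (hη : 0 < η) :
    ∃ p : ℕ → ℝ, (∀ t, 1 ≤ t → p t ∈ Set.Icc (0:ℝ) 1) ∧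
      ∀ᶠ t : ℕ in atTop, ((t : ℝ) + 1) * hsum α β p t (errF α β (p (t+1))) ≤ c * β + η := by
  set p : ℕ → ℝ := fun t => min 1 (c / t) with hpdef
  have hp : ∀ t, 1 ≤ t → p t ∈ Set.Icc (0:ℝ) 1 := by
    intro t _
    exact ⟨le_min zero_le_one (by positivity), min_le_left _ _⟩
  refine ⟨p, hp, ?_⟩
  obtain ⟨T, hT⟩ := exists_nat_gt c
  set r : ℕ → ℝ := fun t => ((t : ℝ) + 1) * hsum α β p t (Vpot σ) with hr
  have hmin0 : ∀ t, 0 ≤ hsum α β p t (fun w => min w.1 w.2) := by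
    intro t
    have h0 := hsum_mono hβ hlt hp t (fun w => 0 * (w.1 + w.2)) (fun w => min w.1 w.2) (by
      intro w hw
      rcases hw with h | rfl
      · rw [zero_mul]; exact (lt_min h.1 h.2).le
      · simp)
    rw [hsum_smul p 0 t (fun w => w.1 + w.2), zero_mul] at h0
    exact h0
  have hminV : ∀ t, hsum α β p t (fun w => min w.1 w.2) ≤ hsum α β p t (Vpot σ) := fun t =>
    hsum_mono hβ hlt hp t _ _ (fun w hw => min_le_Vpot (by linarith) hσ1 hw)
  have hpt : ∀ t : ℕ, T ≤ t → p (t + 1) = c / ((t : ℝ) + 1) := by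
    intro t ht
    have : (T : ℝ) ≤ t := by exact_mod_cast ht
    simp only [hpdef]
    push_cast
    apply min_eq_right
    rw [div_le_one (by positivity)]; linarith
  have hlim := seq_to_zero r (γ * c - 1) (by linarith) T
    (fun t => mul_nonneg (by positivity) ((hmin0 t).trans (hminV t))) (by
    intro t ht
    have hq := hp (t + 1) (by omega)
    have h1 : hsum α β p (t + 1) (Vpot σ) ≤ (1 - γ * p (t + 1)) * hsum α β p t (Vpot σ) := by
      rw [← hsum_smul]
      exact hsum_mono hβ hlt hp t _ _
        (fun w hw => Vpot_step hβ hlt hs hm hσ0 hσ1 hγ hγ0 hq.1 hq.2 hw)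
    rw [hpt t ht] at h1
    have hV0 : 0 ≤ hsum α β p t (Vpot σ) := (hmin0 t).trans (hminV t)
    simp only [hr]
    push_cast
    have hn : (0 : ℝ) < (t : ℝ) + 1 := by positivity
    calc ((t : ℝ) + 1 + 1) * hsum α β p (t + 1) (Vpot σ)
        ≤ ((t : ℝ) + 1 + 1) * ((1 - γ * (c / ((t : ℝ) + 1))) * hsum α β p t (Vpot σ)) := by gcongr
      _ = (((t : ℝ) + 1 + 1) * (1 - γ * (c / ((t : ℝ) + 1)))) * hsum α β p t (Vpot σ) := by ring
      _ ≤ ((1 - (γ * c - 1) / ((t : ℝ) + 1)) * ((t : ℝ) + 1)) * hsum α β p t (Vpot σ) := by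
          apply mul_le_mul_of_nonneg_right _ hV0
          have e1 : ((t : ℝ) + 1 + 1) * (1 - γ * (c / ((t : ℝ) + 1))) =
            (t : ℝ) + 2 - γ * c - γ * c / ((t : ℝ) + 1) := by field_simp; ring
          have e2 : (1 - (γ * c - 1) / ((t : ℝ) + 1)) * ((t : ℝ) + 1) = (t : ℝ) + 2 - γ * c := by
            field_simp; ring
          rw [e1, e2]
          have : 0 < γ * c / ((t : ℝ) + 1) := by positivity
          linarith
      _ = _ := by ring)
  filter_upwards [hlim.eventually_lt_const hη, eventually_ge_atTop T] with t ht1 ht2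
  have h1 := hsum_err_le hβ hlt hs hp t
  have hn : (0 : ℝ) < (t : ℝ) + 1 := by positivity
  calc ((t : ℝ) + 1) * hsum α β p t (errF α β (p (t+1)))
      ≤ ((t : ℝ) + 1) * (p (t+1) * β + hsum α β p t (Vpot σ)) := by
        gcongr; linarith [hminV t]
    _ = c * β + r t := by rw [hpt t ht2]; simp only [hr]; field_simp
    _ ≤ c * β + η := by linarith

theorem det_lower {α β lam m σ γ y : ℝ} (hβ : 0 < β) (hlt : β < α) (hs : α + β = 1)
    (hlam : 0 < lam) (hl : lam = Real.log (α / β)) (hm0 : 0 < m) (hml : m * lam = α - β)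
    (hm : m = β ^ (1 - σ) * α ^ σ) (hσ0 : 1 / 2 ≤ σ) (hσ1 : σ ≤ 1)
    (hγ : γ = (1 - σ) * β + σ * α - m) (hγ0 : 0 < γ) (hy0 : 0 ≤ y) (hy : y < β / γ)
    {p : ℕ → ℝ} (hp : ∀ t, 1 ≤ t → p t ∈ Set.Icc (0:ℝ) 1)
    (hev : ∀ᶠ t : ℕ in atTop, ((t : ℝ) + 1) * hsum α β p t (errF α β (p (t+1))) ≤ y) : False := by
  have hyγ : γ * (y / β) < 1 := by
    rw [lt_div_iff₀ hγ0] at hy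
    rw [← mul_div_assoc, div_lt_one hβ]; linarith
  set Y := y / β with hY
  have hY0 : 0 ≤ Y := by positivity
  obtain ⟨ε, hε, hB⟩ : ∃ ε : ℝ, 0 < ε ∧ (γ + ε) * Y < 1 := by
    refine ⟨(1 - γ * Y) / (2 * (Y + 1)), div_pos (by linarith) (by positivity), ?_⟩
    have : (1 - γ * Y) / (2 * (Y + 1)) * Y ≤ (1 - γ * Y) / 2 := by
      rw [div_mul_eq_mul_div, div_le_div_iff₀ (by positivity) (by norm_num)]
      nlinarith
    linarith
  obtain ⟨K, p0, hK, hp0, hp0h, hstep⟩ := bump_step α β lam m σ γ hβ hlt hs hlam hm0 hml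
    (by linarith) hσ1 hγ ε hε
  set B := (γ + ε) * Y with hBdef
  have hB0 : 0 ≤ B := by positivity
  obtain ⟨T1, hT1⟩ := eventually_atTop.mp hev
  obtain ⟨T2, hT2⟩ := exists_nat_gt (Y / p0)
  obtain ⟨T3, hT3⟩ := exists_nat_gt (2 * B / (1 - B))
  set T := T1 + T2 + T3 with hT
  have hmin0 : ∀ t, 0 ≤ hsum α β p t (fun w => min w.1 w.2) := by
    intro t
    have h0 := hsum_mono hβ hlt hp t (fun w => 0 * (w.1 + w.2)) (fun w => min w.1 w.2) (by
      intro w hw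
      rcases hw with h | rfl
      · rw [zero_mul]; exact (lt_min h.1 h.2).le
      · simp)
    rw [hsum_smul p 0 t (fun w => w.1 + w.2), zero_mul] at h0
    exact h0
  have hcast : ∀ t : ℕ, T ≤ t → (T1 : ℝ) ≤ t ∧ (T2 : ℝ) ≤ t ∧ (T3 : ℝ) ≤ t := by
    intro t ht
    refine ⟨?_, ?_, ?_⟩ <;> (norm_cast; omega)
  have hmain : ∀ t : ℕ, T ≤ t →
      p (t + 1) ≤ Y / ((t : ℝ) + 1) ∧ p (t + 1) ≤ p0 ∧
      ((t : ℝ) + 1) * hsum α β p t (fun w => min w.1 w.2) ≤ 2 * Y := by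
    intro t ht
    obtain ⟨c1, c2, c3⟩ := hcast t ht
    have hq := hp (t + 1) (by omega)
    have h1 := hT1 t (by omega)
    have h2 := hsum_err_ge hβ hlt hs hp t
    have hn : (0 : ℝ) < (t : ℝ) + 1 := by positivity
    have h3 := mul_le_mul_of_nonneg_left h2 hn.le
    set S := hsum α β p t (fun w => min w.1 w.2) with hS
    have hS0 : 0 ≤ S := hmin0 t
    have h4 : ((t : ℝ) + 1) * (p (t+1) * β + (1 - p (t+1)) * β * S) ≤ y := h3.trans h1
    have h5 : ((t : ℝ) + 1) * (p (t+1) + (1 - p (t+1)) * S) ≤ Y := by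
      rw [hY, le_div_iff₀ hβ]; linarith
    have h6 : 0 ≤ (1 - p (t+1)) * S := mul_nonneg (by linarith [hq.2]) hS0
    have h7 : p (t + 1) ≤ Y / ((t : ℝ) + 1) := by
      rw [le_div_iff₀ hn]
      have : 0 ≤ ((t : ℝ) + 1) * ((1 - p (t+1)) * S) := by positivity
      linarith
    have h8 : p (t + 1) ≤ p0 := by
      refine h7.trans ?_
      rw [div_le_iff₀ hn]
      rw [div_lt_iff₀ hp0] at hT2
      nlinarith
    refine ⟨h7, h8, ?_⟩
    have h9 : S / 2 ≤ (1 - p (t+1)) * S := by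
      have : (1 / 2) * S ≤ (1 - p (t+1)) * S := by gcongr; linarith
      linarith
    have h10 : ((t : ℝ) + 1) * (S / 2) ≤ ((t : ℝ) + 1) * (p (t+1) + (1 - p (t+1)) * S) := by
      gcongr; linarith [hq.1]
    linarith
  set r : ℕ → ℝ := fun t => ((t : ℝ) + 1) * hsum α β p t (Wpot σ lam K) with hr
  set C := Real.exp (lam * (K + 1)) * K ^ 3 with hC
  have hK0 : 0 ≤ K := by linarith
  have hC0 : 0 ≤ C := by positivity
  have hW0 : ∀ t, 0 < hsum α β p (t + 2) (Wpot σ lam K) :=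
    Wpot_pos hβ hlt hs hlam hl hK hp
  obtain ⟨t, ht, hlt'⟩ := seq_unbounded r ((1 - B) / 2) (by linarith) (T + 2)
    (mul_pos (by positivity) (hW0 T)) (by
      intro t ht
      obtain ⟨m1, m2, m3⟩ := hmain t (by omega)
      obtain ⟨c1, c2, c3⟩ := hcast t (by omega)
      have hq := hp (t + 1) (by omega)
      have h1 : (1 - (γ + ε) * p (t + 1)) * hsum α β p t (Wpot σ lam K) ≤
          hsum α β p (t + 1) (Wpot σ lam K) := by
        rw [← hsum_smul]
        exact hsum_mono hβ hlt hp t _ _ (fun w hw => Wpot_step hβ hlt hs hlam hl hm (by linarith)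
          hq.1 hq.2 (fun x hx0 hxK => hstep (p (t+1)) x hq.1 m2 hx0 hxK) hw)
      have hS0 : 0 < hsum α β p t (Wpot σ lam K) := by
        obtain ⟨u, rfl⟩ : ∃ u, t = u + 2 := ⟨t - 2, by omega⟩
        exact hW0 u
      set S := hsum α β p t (Wpot σ lam K) with hS
      simp only [hr]
      push_cast
      rw [← hS]
      have hn : (0 : ℝ) < (t : ℝ) + 1 := by positivity
      have h2 : (1 - B / ((t : ℝ) + 1)) ≤ 1 - (γ + ε) * p (t + 1) := by
        have : (γ + ε) * p (t + 1) ≤ (γ + ε) * (Y / ((t : ℝ) + 1)) := by gcongr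
        rw [← mul_div_assoc] at this
        linarith
      have h3 : (1 + (1 - B) / 2 / ((t : ℝ) + 1)) * ((t : ℝ) + 1) ≤
          ((t : ℝ) + 1 + 1) * (1 - B / ((t : ℝ) + 1)) := by
        have e1 : (1 + (1 - B) / 2 / ((t : ℝ) + 1)) * ((t : ℝ) + 1) = (t : ℝ) + 1 + (1 - B) / 2 := by
          field_simp
        have e2 : ((t : ℝ) + 1 + 1) * (1 - B / ((t : ℝ) + 1)) =
          (t : ℝ) + 2 - B - B / ((t : ℝ) + 1) := by field_simp; ring
        rw [e1, e2]
        have h4 : B / ((t : ℝ) + 1) ≤ (1 - B) / 2 := by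
          rw [div_le_iff₀ hn]
          rw [div_lt_iff₀ (by linarith)] at hT3
          have : (T3 : ℝ) * (1 - B) ≤ ((t : ℝ) + 1) * (1 - B) := by
            apply mul_le_mul_of_nonneg_right _ (by linarith)
            linarith
          linarith
        linarith
      calc (1 + (1 - B) / 2 / ((t : ℝ) + 1)) * (((t : ℝ) + 1) * S)
          = ((1 + (1 - B) / 2 / ((t : ℝ) + 1)) * ((t : ℝ) + 1)) * S := by ring
        _ ≤ (((t : ℝ) + 1 + 1) * (1 - B / ((t : ℝ) + 1))) * S := by gcongr
        _ = ((t : ℝ) + 1 + 1) * ((1 - B / ((t : ℝ) + 1)) * S) := by ring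
        _ ≤ ((t : ℝ) + 1 + 1) * ((1 - (γ + ε) * p (t + 1)) * S) := by gcongr
        _ ≤ _ := by gcongr)
    (C * (2 * Y))
  obtain ⟨m1, m2, m3⟩ := hmain t (by omega)
  have h1 : hsum α β p t (Wpot σ lam K) ≤ C * hsum α β p t (fun w => min w.1 w.2) := by
    rw [← hsum_smul]
    exact hsum_mono hβ hlt hp t _ _ (fun w hw => Wpot_le_min hβ hlt hlam hl (by linarith) hσ1
      hK0 hw)
  have h2 : r t ≤ C * (2 * Y) := by
    calc r t ≤ ((t : ℝ) + 1) * (C * hsum α β p t (fun w => min w.1 w.2)) := by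
          simp only [hr]; gcongr
      _ = C * (((t : ℝ) + 1) * hsum α β p t (fun w => min w.1 w.2)) := by ring
      _ ≤ C * (2 * Y) := by gcongr
  linarith

/-! ### The cascade and the deterministic dynamics -/

section Prob
variable {Ω : Type*} [MeasurableSpace Ω] {μ : Measure Ω}

theorem split_two [IsFiniteMeasure μ] (E : Set Ω) {f : Ω → ℕ} (hf : Measurable f) {u v : ℕ}
    (huv : u ≠ v) (hr : ∀ ω, f ω = u ∨ f ω = v) :
    (μ E).toReal = (μ (E ∩ {ω | f ω = u})).toReal + (μ (E ∩ {ω | f ω = v})).toReal := by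
  have hm : MeasurableSet {ω | f ω = u} := hf (measurableSet_singleton u)
  have e : E ∩ {ω | f ω = v} = E \ {ω | f ω = u} := by
    ext ω
    simp only [Set.mem_inter_iff, Set.mem_setOf_eq, Set.mem_diff]
    rcases hr ω with h | h <;> simp [h, huv, huv.symm]
  rw [e, ← ENNReal.toReal_add (measure_ne_top _ _) (measure_ne_top _ _),
    measure_inter_add_diff E hm]

/-- joint likelihood pair of a history -/
def wt (μ : Measure Ω) (θ : Ω → ℕ) (Z : ℕ → Ω → ℕ) (t : ℕ) (z : ℕ → ℕ) : ℝ × ℝ :=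
  ((μ {ω | θ ω = 1 ∧ ∀ s ∈ Finset.Icc 1 t, Z s ω = z s}).toReal,
    (μ {ω | θ ω = 2 ∧ ∀ s ∈ Finset.Icc 1 t, Z s ω = z s}).toReal)

/-- component -/
def comp (w : ℝ × ℝ) (i : ℕ) : ℝ := if i = 1 then w.1 else w.2

theorem comp_wt (θ : Ω → ℕ) (Z : ℕ → Ω → ℕ) (t : ℕ) (z : ℕ → ℕ) (i : ℕ) (hi : i = 1 ∨ i = 2) :
    comp (wt μ θ Z t z) i =
      (μ {ω | θ ω = i ∧ ∀ s ∈ Finset.Icc 1 t, Z s ω = z s}).toReal := by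
  rcases hi with rfl | rfl <;> simp [comp, wt]

/-- revealing probabilities -/
def rp (p : ℕ → ℝ) (t c : ℕ) : ℝ := if c = 1 then p t else 1 - p t

/-- the independence property at time `t` -/
def IndepAt (a b : ℝ) (p : ℕ → ℝ) (μ : Measure Ω) (θ : Ω → ℕ) (X I Z : ℕ → Ω → ℕ) (t : ℕ) : Prop :=
  ∀ z : ℕ → ℕ, (∀ s, z s = 1 ∨ z s = 2) → ∀ i : ℕ, i = 1 ∨ i = 2 → ∀ S : Finset ℕ,
    (∀ s ∈ S, t + 1 ≤ s) → ∀ x c : ℕ → ℕ, (∀ t, x t = 1 ∨ x t = 2) → (∀ t, c t = 0 ∨ c t = 1) →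
    (μ {ω | (θ ω = i ∧ ∀ s ∈ Finset.Icc 1 t, Z s ω = z s) ∧
      ∀ s ∈ S, X s ω = x s ∧ I s ω = c s}).toReal
      = comp (wt μ θ Z t z) i *
        ∏ s ∈ S, (sg (a / (a + b)) (b / (a + b)) i (x s) * rp p s (c s))

variable {a b : ℝ} {p : ℕ → ℝ} {θ : Ω → ℕ} {X I Z : ℕ → Ω → ℕ}

theorem theta_half (h : IsCascade a b p μ θ X I Z) (i : ℕ) (hi : i = 1 ∨ i = 2) :
    (μ {ω | θ ω = i}).toReal = 1 / 2 := by
  have := h.joint i hi ∅ (by simp) (fun _ => 1) (fun _ => 0) (by simp) (by simp)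
  simpa using this

theorem indep_zero (h : IsCascade a b p μ θ X I Z) : IndepAt a b p μ θ X I Z 0 := by
  intro z hz i hi S hS x c hx hc
  have h1 := h.joint i hi S (by simpa using hS) x c hx hc
  rw [comp_wt _ _ _ _ _ hi]
  have h2 := theta_half h i hi
  simp only [Finset.Icc_eq_empty_of_lt (show (0:ℕ) < 1 by norm_num), Finset.notMem_empty,
    false_imp_iff, imp_true_iff, and_true]
  rw [h2, h1]
  rfl

theorem map_eq (h : IsCascade a b p μ θ X I Z) (t : ℕ) (hI : IndepAt a b p μ θ X I Z t)
    (z : ℕ → ℕ) (hz : ∀ s, z s = 1 ∨ z s = 2) (ω : Ω)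
    (hω : ∀ s ∈ Finset.Icc 1 t, Z s ω = z s) :
    mapEst μ θ X Z (t + 1) ω =
      Mest (a / (a + b)) (b / (a + b)) (wt μ θ Z t z) (X (t + 1) ω) := by
  haveI := h.prob
  have hD : ∀ i, i = 1 ∨ i = 2 → Dlike μ θ X Z (t + 1) i ω =
      2 * (comp (wt μ θ Z t z) i * sg (a / (a + b)) (b / (a + b)) i (X (t + 1) ω)) := by
    intro i hi
    unfold Dlike
    rw [theta_half h i hi]
    have e : {ω' | θ ω' = i ∧ (∀ s ∈ Finset.Icc 1 (t + 1 - 1), Z s ω' = Z s ω) ∧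
        X (t + 1) ω' = X (t + 1) ω} =
        {ω' | (θ ω' = i ∧ ∀ s ∈ Finset.Icc 1 t, Z s ω' = z s) ∧ X (t + 1) ω' = X (t + 1) ω} := by
      ext ω'
      simp only [Set.mem_setOf_eq, Nat.add_sub_cancel]
      rw [← and_assoc]
      refine and_congr_left fun _ => and_congr_right fun _ => ?_
      exact forall₂_congr fun s hs => by rw [hω s hs]
    rw [e, split_two _ (h.I_meas (t + 1)) (show (0:ℕ) ≠ 1 by norm_num) (h.I_range (t + 1))]
    have hp : ∀ c0, c0 = 0 ∨ c0 = 1 →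
      (μ ({ω' | (θ ω' = i ∧ ∀ s ∈ Finset.Icc 1 t, Z s ω' = z s) ∧ X (t + 1) ω' = X (t + 1) ω} ∩
        {ω' | I (t + 1) ω' = c0})).toReal = comp (wt μ θ Z t z) i *
          (sg (a / (a + b)) (b / (a + b)) i (X (t + 1) ω) * rp p (t + 1) c0) := by
      intro c0 hc0
      have := hI z hz i hi {t + 1} (by simp) (fun _ => X (t + 1) ω) (fun _ => c0)
        (fun _ => h.X_range _ _) (fun _ => hc0)
      rw [Finset.prod_singleton] at this
      rw [← this]
      congr 2
      ext ω'
      simp only [Set.mem_inter_iff, Set.mem_setOf_eq, Finset.mem_singleton, forall_eq]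
      tauto
    rw [hp 0 (Or.inl rfl), hp 1 (Or.inr rfl)]
    simp only [rp]
    norm_num
    ring
  unfold mapEst Mest
  rw [hD 1 (Or.inl rfl), hD 2 (Or.inr rfl)]
  simp only [comp]
  norm_num

theorem pieces (h : IsCascade a b p μ θ X I Z) (t : ℕ) (hI : IndepAt a b p μ θ X I Z t)
    (z : ℕ → ℕ) (hz : ∀ s, z s = 1 ∨ z s = 2) (i : ℕ) (hi : i = 1 ∨ i = 2) (S : Finset ℕ)
    (hS : ∀ s ∈ S, t + 2 ≤ s) (x c : ℕ → ℕ) (hx : ∀ t, x t = 1 ∨ x t = 2)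
    (hc : ∀ t, c t = 0 ∨ c t = 1) :
    (μ {ω | (θ ω = i ∧ ∀ s ∈ Finset.Icc 1 (t + 1), Z s ω = z s) ∧
      ∀ s ∈ S, X s ω = x s ∧ I s ω = c s}).toReal
      = comp (wt μ θ Z t z) i *
        kern (a / (a + b)) (b / (a + b)) (p (t + 1)) (wt μ θ Z t z) i (z (t + 1)) *
        ∏ s ∈ S, (sg (a / (a + b)) (b / (a + b)) i (x s) * rp p s (c s)) := by
  haveI := h.prob
  set w := wt μ θ Z t z with hw
  set α := a / (a + b)
  set β := b / (a + b)
  set Pr := ∏ s ∈ S, (sg α β i (x s) * rp p s (c s)) with hPr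
  set E := {ω | (θ ω = i ∧ ∀ s ∈ Finset.Icc 1 (t + 1), Z s ω = z s) ∧
      ∀ s ∈ S, X s ω = x s ∧ I s ω = c s} with hE
  have hnot : t + 1 ∉ S := fun h' => by have := hS _ h'; omega
  have key : ∀ x0 c0, (x0 = 1 ∨ x0 = 2) → (c0 = 0 ∨ c0 = 1) →
      (μ (E ∩ {ω | X (t + 1) ω = x0} ∩ {ω | I (t + 1) ω = c0})).toReal =
      if (if c0 = 1 then x0 else Mest α β w x0) = z (t + 1) then
        comp w i * (sg α β i x0 * rp p (t + 1) c0 * Pr) else 0 := by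
    intro x0 c0 hx0 hc0
    have hact : ∀ ω, (∀ s ∈ Finset.Icc 1 t, Z s ω = z s) → X (t + 1) ω = x0 →
        I (t + 1) ω = c0 → Z (t + 1) ω = if c0 = 1 then x0 else Mest α β w x0 := by
      intro ω h1 h2 h3
      rw [h.dynamics (t + 1) (by omega) ω, map_eq h t hI z hz ω h1, h2, h3]
    have hIcc : ∀ ω, (∀ s ∈ Finset.Icc 1 (t + 1), Z s ω = z s) ↔
        (∀ s ∈ Finset.Icc 1 t, Z s ω = z s) ∧ Z (t + 1) ω = z (t + 1) := by
      intro ω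
      constructor
      · intro h1
        refine ⟨fun s hs => h1 s ?_, h1 _ ?_⟩
        · rw [Finset.mem_Icc] at *; omega
        · rw [Finset.mem_Icc]; omega
      · rintro ⟨h1, h2⟩ s hs
        rw [Finset.mem_Icc] at hs
        rcases Nat.lt_or_ge s (t + 1) with h3 | h3
        · exact h1 s (by rw [Finset.mem_Icc]; omega)
        · have : s = t + 1 := by omega
          rw [this]; exact h2
    by_cases hcond : (if c0 = 1 then x0 else Mest α β w x0) = z (t + 1)
    · rw [if_pos hcond]
      have := hI z hz i hi (insert (t + 1) S) (by
          intro s hs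
          rw [Finset.mem_insert] at hs
          rcases hs with rfl | hs
          · omega
          · have := hS s hs; omega)
        (Function.update x (t + 1) x0) (Function.update c (t + 1) c0)
        (by intro s; by_cases hs : s = t + 1
            · subst hs; simpa using hx0
            · simpa [hs] using hx s)
        (by intro s; by_cases hs : s = t + 1
            · subst hs; simpa using hc0
            · simpa [hs] using hc s)
      rw [Finset.prod_insert hnot] at this
      simp only [Function.update_self] at this
      have hprod : ∏ s ∈ S, (sg α β i (Function.update x (t + 1) x0 s) *
          rp p s (Function.update c (t + 1) c0 s)) = Pr := by
        apply Finset.prod_congr rfl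
        intro s hs
        have hne : s ≠ t + 1 := fun h' => hnot (h' ▸ hs)
        rw [Function.update_of_ne hne, Function.update_of_ne hne]
      rw [hprod] at this
      rw [← this]
      congr 2
      ext ω
      simp only [hE, Set.mem_inter_iff, Set.mem_setOf_eq, hIcc, Finset.mem_insert,
        forall_eq_or_imp, Function.update_self]
      have hS' : (∀ s ∈ S, X s ω = Function.update x (t + 1) x0 s ∧
          I s ω = Function.update c (t + 1) c0 s) ↔ ∀ s ∈ S, X s ω = x s ∧ I s ω = c s := by
        refine forall₂_congr fun s hs => ?_
        have hne : s ≠ t + 1 := fun h' => hnot (h' ▸ hs)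
        rw [Function.update_of_ne hne, Function.update_of_ne hne]
      rw [hS']
      constructor
      · rintro ⟨⟨⟨⟨h1, h2, h3⟩, h4⟩, h5⟩, h6⟩
        exact ⟨⟨h1, h2⟩, ⟨h5, h6⟩, h4⟩
      · rintro ⟨⟨h1, h2⟩, ⟨h5, h6⟩, h4⟩
        exact ⟨⟨⟨⟨h1, h2, (hact ω h2 h5 h6).trans hcond⟩, h4⟩, h5⟩, h6⟩
    · rw [if_neg hcond]
      have : E ∩ {ω | X (t + 1) ω = x0} ∩ {ω | I (t + 1) ω = c0} = ∅ := by
        rw [Set.eq_empty_iff_forall_notMem]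
        rintro ω ⟨⟨h1, h2⟩, h3⟩
        rw [hE, Set.mem_setOf_eq, hIcc] at h1
        exact hcond ((hact ω h1.1.2.1 h2 h3).symm.trans h1.1.2.2)
      rw [this]; simp
  rw [split_two E (h.X_meas (t + 1)) (show (1:ℕ) ≠ 2 by norm_num) (h.X_range (t + 1)),
    split_two (E ∩ {ω | X (t + 1) ω = 1}) (h.I_meas (t + 1)) (show (0:ℕ) ≠ 1 by norm_num)
      (h.I_range (t + 1)),
    split_two (E ∩ {ω | X (t + 1) ω = 2}) (h.I_meas (t + 1)) (show (0:ℕ) ≠ 1 by norm_num)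
      (h.I_range (t + 1)),
    key 1 0 (Or.inl rfl) (Or.inl rfl), key 1 1 (Or.inl rfl) (Or.inr rfl),
    key 2 0 (Or.inr rfl) (Or.inl rfl), key 2 1 (Or.inr rfl) (Or.inr rfl)]
  simp only [rp, kern]
  have hsel : (if (1:ℕ) = z (t + 1) then sg α β i 1 else 0) +
      (if (2:ℕ) = z (t + 1) then sg α β i 2 else 0) = sg α β i (z (t + 1)) := by
    rcases hz (t + 1) with h1 | h1 <;> rw [h1] <;> simp
  rw [← hsel]
  simp only [zero_ne_one, if_false, if_true]
  split_ifs <;> ring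

theorem indep_all (h : IsCascade a b p μ θ X I Z) (t : ℕ) : IndepAt a b p μ θ X I Z t := by
  induction t with
  | zero => exact indep_zero h
  | succ t ih =>
    intro z hz i hi S hS x c hx hc
    rw [pieces h t ih z hz i hi S (by intro s hs; have := hS s hs; omega) x c hx hc]
    congr 1
    have := pieces h t ih z hz i hi ∅ (by simp) x c hx hc
    rw [comp_wt (μ := μ) θ Z (t+1) z i hi]
    simpa using this.symm

theorem wt_succ (h : IsCascade a b p μ θ X I Z) (t : ℕ)
    (z : ℕ → ℕ) (hz : ∀ s, z s = 1 ∨ z s = 2) :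
    wt μ θ Z (t + 1) z =
      nxt (a / (a + b)) (b / (a + b)) (p (t + 1)) (wt μ θ Z t z) (z (t + 1)) := by
  have h1 := pieces h t (indep_all h t) z hz 1 (Or.inl rfl) ∅ (by simp) (fun _ => 1) (fun _ => 0)
    (by simp) (by simp)
  have h2 := pieces h t (indep_all h t) z hz 2 (Or.inr rfl) ∅ (by simp) (fun _ => 1) (fun _ => 0)
    (by simp) (by simp)
  unfold nxt
  conv_lhs => unfold wt
  simp [comp] at h1 h2
  simp only [Prod.mk.injEq]
  refine ⟨?_, ?_⟩
  · rw [← h1]; simp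
  · rw [← h2]; simp

/-- history encoded by the set of times with action 2 -/
def zA (A : Finset ℕ) (s : ℕ) : ℕ := if s ∈ A then 2 else 1

theorem zA_range (A : Finset ℕ) (s : ℕ) : zA A s = 1 ∨ zA A s = 2 := by
  unfold zA; split_ifs <;> simp

theorem wt_congr (t : ℕ) (z z' : ℕ → ℕ) (hzz : ∀ s ∈ Finset.Icc 1 t, z s = z' s) :
    wt μ θ Z t z = wt μ θ Z t z' := by
  have : ∀ i, {ω | θ ω = i ∧ ∀ s ∈ Finset.Icc 1 t, Z s ω = z s} =
      {ω | θ ω = i ∧ ∀ s ∈ Finset.Icc 1 t, Z s ω = z' s} := by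
    intro i; ext ω
    simp only [Set.mem_setOf_eq]
    exact and_congr_right fun _ => forall₂_congr fun s hs => by rw [hzz s hs]
  unfold wt; rw [this, this]

theorem Icc_succ (t : ℕ) : Finset.Icc 1 (t + 1) = insert (t + 1) (Finset.Icc 1 t) := by
  ext s; simp only [Finset.mem_insert, Finset.mem_Icc]; omega

theorem not_mem_Icc (t : ℕ) : t + 1 ∉ Finset.Icc 1 t := by simp

theorem wt_zero_step (h : IsCascade a b p μ θ X I Z) (t : ℕ) (A : Finset ℕ)
    (hA : A ∈ (Finset.Icc 1 t).powerset) :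
    wt μ θ Z (t + 1) (zA A) =
      nxt (a / (a + b)) (b / (a + b)) (p (t + 1)) (wt μ θ Z t (zA A)) 1 := by
  rw [wt_succ h t _ (zA_range A)]
  have : zA A (t + 1) = 1 := by
    unfold zA; rw [if_neg]
    intro h'; exact not_mem_Icc t (Finset.mem_powerset.mp hA h')
  rw [this]

theorem wt_one_step (h : IsCascade a b p μ θ X I Z) (t : ℕ) (A : Finset ℕ) :
    wt μ θ Z (t + 1) (zA (insert (t + 1) A)) =
      nxt (a / (a + b)) (b / (a + b)) (p (t + 1)) (wt μ θ Z t (zA A)) 2 := by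
  rw [wt_succ h t _ (zA_range _)]
  have : zA (insert (t + 1) A) (t + 1) = 2 := by simp [zA]
  rw [this, wt_congr t (zA (insert (t + 1) A)) (zA A)]
  intro s hs
  have : s ≠ t + 1 := fun h' => not_mem_Icc t (h' ▸ hs)
  simp [zA, this]

theorem sum_hist (h : IsCascade a b p μ θ X I Z) (t : ℕ) : ∀ φ : ℝ × ℝ → ℝ,
    ∑ A ∈ (Finset.Icc 1 t).powerset, φ (wt μ θ Z t (zA A)) =
      hsum (a / (a + b)) (b / (a + b)) p t φ := by
  induction t with
  | zero =>
    intro φ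
    have h1 := theta_half h 1 (Or.inl rfl)
    have h2 := theta_half h 2 (Or.inr rfl)
    simp [hsum, wt, h1, h2]
  | succ t ih =>
    intro φ
    rw [Icc_succ, Finset.sum_powerset_insert (not_mem_Icc t)]
    show _ = hsum _ _ p t _
    rw [← ih, ← Finset.sum_add_distrib]
    apply Finset.sum_congr rfl
    intro A hA
    rw [wt_zero_step h t A hA, wt_one_step h t A]
    rfl

theorem Z_range (h : IsCascade a b p μ θ X I Z) (t : ℕ) (ω : Ω) :
    Z (t + 1) ω = 1 ∨ Z (t + 1) ω = 2 := by
  rw [h.dynamics (t + 1) (by omega) ω]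
  unfold mapEst
  have := h.X_range (t + 1) ω
  split_ifs <;> simp_all

theorem hist_partition (h : IsCascade a b p μ θ X I Z) (t : ℕ) : ∀ E : Set Ω,
    (μ E).toReal = ∑ A ∈ (Finset.Icc 1 t).powerset,
      (μ (E ∩ {ω | ∀ s ∈ Finset.Icc 1 t, Z s ω = zA A s})).toReal := by
  haveI := h.prob
  induction t with
  | zero => intro E; simp
  | succ t ih =>
    intro E
    rw [split_two E (h.Z_meas (t + 1)) (show (1:ℕ) ≠ 2 by norm_num) (Z_range h t), ih, ih,
      Icc_succ, Finset.sum_powerset_insert (not_mem_Icc t)]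
    congr 1
    · apply Finset.sum_congr rfl
      intro A hA
      have hz : zA A (t + 1) = 1 := by
        unfold zA; rw [if_neg]
        intro h'; exact not_mem_Icc t (Finset.mem_powerset.mp hA h')
      congr 2
      ext ω
      simp only [Set.mem_inter_iff, Set.mem_setOf_eq, Finset.mem_insert, forall_eq_or_imp, hz]
      tauto
    · apply Finset.sum_congr rfl
      intro A hA
      have hz : zA (insert (t + 1) A) (t + 1) = 2 := by simp [zA]
      have hz2 : ∀ ω, (∀ s ∈ Finset.Icc 1 t, Z s ω = zA (insert (t + 1) A) s) ↔
          (∀ s ∈ Finset.Icc 1 t, Z s ω = zA A s) := by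
        intro ω
        refine forall₂_congr fun s hs => ?_
        have : s ≠ t + 1 := fun h' => not_mem_Icc t (h' ▸ hs)
        simp [zA, this]
      congr 2
      ext ω
      simp only [Set.mem_inter_iff, Set.mem_setOf_eq, Finset.mem_insert, forall_eq_or_imp, hz, hz2]
      tauto

theorem err_eq (h : IsCascade a b p μ θ X I Z) (t : ℕ) :
    (μ {ω | Z (t + 1) ω ≠ θ ω}).toReal =
      hsum (a / (a + b)) (b / (a + b)) p t (errF (a / (a + b)) (b / (a + b)) (p (t + 1))) := by
  haveI := h.prob
  rw [← sum_hist h t, split_two _ h.theta_meas (show (1:ℕ) ≠ 2 by norm_num) h.theta_range,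
    hist_partition h t, hist_partition h t, ← Finset.sum_add_distrib]
  apply Finset.sum_congr rfl
  intro A hA
  unfold errF
  rw [← wt_one_step h t A, ← wt_zero_step h t A hA]
  unfold wt
  simp only
  congr 3
  · ext ω
    have hz : zA (insert (t + 1) A) (t + 1) = 2 := by simp [zA]
    have hz2 : (∀ s ∈ Finset.Icc 1 t, Z s ω = zA (insert (t + 1) A) s) ↔
        (∀ s ∈ Finset.Icc 1 t, Z s ω = zA A s) := by
      refine forall₂_congr fun s hs => ?_
      have : s ≠ t + 1 := fun h' => not_mem_Icc t (h' ▸ hs)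
      simp [zA, this]
    simp only [Icc_succ, Set.mem_inter_iff, Set.mem_setOf_eq, Finset.mem_insert,
      forall_eq_or_imp, hz, hz2]
    have := Z_range h t ω
    constructor
    · rintro ⟨⟨h1, h2⟩, h3⟩
      refine ⟨h2, ?_, h3⟩
      rw [h2] at h1; tauto
    · rintro ⟨h2, h1, h3⟩
      exact ⟨⟨by rw [h1, h2]; norm_num, h2⟩, h3⟩
  · ext ω
    have hz : zA A (t + 1) = 1 := by
      unfold zA; rw [if_neg]
      intro h'; exact not_mem_Icc t (Finset.mem_powerset.mp hA h')
    simp only [Icc_succ, Set.mem_inter_iff, Set.mem_setOf_eq, Finset.mem_insert,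
      forall_eq_or_imp, hz]
    have := Z_range h t ω
    constructor
    · rintro ⟨⟨h1, h2⟩, h3⟩
      refine ⟨h2, ?_, h3⟩
      rw [h2] at h1; tauto
    · rintro ⟨h2, h1, h3⟩
      exact ⟨⟨by rw [h1, h2]; norm_num, h2⟩, h3⟩

end Prob

/-! ### Existence of the model -/

section Model

/-- clipping to the unit interval -/
def clip (q : ℝ) : ℝ := max 0 (min q 1)

theorem clip_of_mem {q : ℝ} (h0 : 0 ≤ q) (h1 : q ≤ 1) : clip q = q := by
  unfold clip; rw [min_eq_left h1, max_eq_right h0]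

theorem clip_nonneg (q : ℝ) : 0 ≤ clip q := le_max_left _ _

theorem clip_le (q : ℝ) : clip q ≤ 1 := max_le zero_le_one (min_le_right _ _)

/-- Bernoulli measure -/
def bern (q : ℝ) : Measure Bool :=
  ENNReal.ofReal (clip q) • Measure.dirac true + ENNReal.ofReal (1 - clip q) • Measure.dirac false

instance bern_prob (q : ℝ) : IsProbabilityMeasure (bern q) := by
  constructor
  simp only [bern, Measure.add_apply, Measure.smul_apply, measure_univ, smul_eq_mul, mul_one]
  rw [← ENNReal.ofReal_add (clip_nonneg q) (by linarith [clip_le q])]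
  simp

theorem bern_true {q : ℝ} (h0 : 0 ≤ q) (h1 : q ≤ 1) : (bern q {true}).toReal = q := by
  simp [bern, clip_of_mem h0 h1, h0]

theorem bern_false {q : ℝ} (h0 : 0 ≤ q) (h1 : q ≤ 1) : (bern q {false}).toReal = 1 - q := by
  simp [bern, clip_of_mem h0 h1, h1]

/-- success probability of the first coordinate -/
def qm (α : ℝ) (t : ℕ) : ℝ := if t = 0 then 1 / 2 else α

/-- sample space measure -/
def mm (α : ℝ) (p : ℕ → ℝ) : Measure (ℕ → Bool × Bool) :=
  Measure.infinitePi (fun t => (bern (qm α t)).prod (bern (p t)))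

instance mm_prob (α : ℝ) (p : ℕ → ℝ) : IsProbabilityMeasure (mm α p) := by
  unfold mm; infer_instance

/-- state -/
def thm (ω : ℕ → Bool × Bool) : ℕ := if (ω 0).1 = true then 1 else 2

/-- signal -/
def Xm (t : ℕ) (ω : ℕ → Bool × Bool) : ℕ := if (ω t).1 = true then thm ω else 3 - thm ω

/-- indicator -/
def Im (t : ℕ) (ω : ℕ → Bool × Bool) : ℕ := if (ω t).2 = true then 1 else 0

theorem thm_range (ω : ℕ → Bool × Bool) : thm ω = 1 ∨ thm ω = 2 := by
  unfold thm; split_ifs <;> simp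

theorem thm_meas : Measurable thm := by
  have h : Measurable (fun u : Bool × Bool => if u.1 = true then 1 else 2) :=
    measurable_of_countable _
  exact h.comp (measurable_pi_apply 0)

theorem Xm_meas (t : ℕ) : Measurable (Xm t) := by
  have h : Measurable (fun u : (Bool × Bool) × ℕ => if u.1.1 = true then u.2 else 3 - u.2) :=
    measurable_of_countable _
  exact h.comp ((measurable_pi_apply t).prodMk thm_meas)

theorem Im_meas (t : ℕ) : Measurable (Im t) := by
  have h : Measurable (fun u : Bool × Bool => if u.2 = true then 1 else 0) :=
    measurable_of_countable _
  exact h.comp (measurable_pi_apply t)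

theorem joint_m (a b : ℝ) (ha : 0 < a) (hb : 0 < b) (p : ℕ → ℝ)
    (hp : ∀ t, 1 ≤ t → p t ∈ Set.Icc (0:ℝ) 1) (i : ℕ) (hi : i = 1 ∨ i = 2) (s : Finset ℕ)
    (hs : ∀ t ∈ s, 1 ≤ t) (x c : ℕ → ℕ) (hx : ∀ t, x t = 1 ∨ x t = 2)
    (hc : ∀ t, c t = 0 ∨ c t = 1) :
    ((mm (a / (a + b)) p) {ω | thm ω = i ∧ ∀ t ∈ s, Xm t ω = x t ∧ Im t ω = c t}).toReal
      = 1 / 2 * ∏ t ∈ s, signalProb a b i (x t) * (if c t = 1 then p t else 1 - p t) := by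
  set T : ℕ → Set (Bool × Bool) := fun t =>
    if t = 0 then {decide (i = 1)} ×ˢ Set.univ else {decide (x t = i)} ×ˢ {decide (c t = 1)} with hT
  have h0 : 0 ∉ s := fun h => by have := hs 0 h; omega
  have e : {ω | thm ω = i ∧ ∀ t ∈ s, Xm t ω = x t ∧ Im t ω = c t} =
      Set.pi ((insert 0 s : Finset ℕ) : Set ℕ) T := by
    ext ω
    have h1 : ω 0 ∈ T 0 ↔ thm ω = i := by
      simp only [hT, thm, if_true, Set.mem_prod, Set.mem_singleton_iff]
      rcases hi with rfl | rfl <;> cases h : (ω 0).1 <;> simp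
    have h2 : thm ω = i → ∀ t ∈ s, (ω t ∈ T t ↔ Xm t ω = x t ∧ Im t ω = c t) := by
      intro hth t ht
      have ht0 : t ≠ 0 := fun h => h0 (h ▸ ht)
      simp only [hT, if_neg ht0, Set.mem_prod, Set.mem_singleton_iff, Xm, Im, hth]
      rcases hi with rfl | rfl <;> rcases hx t with h3 | h3 <;> rcases hc t with h4 | h4 <;>
        cases h5 : (ω t).1 <;> cases h6 : (ω t).2 <;> simp [h3, h4]
    simp only [Finset.coe_insert, Set.mem_pi, Set.mem_insert_iff, forall_eq_or_imp, h1]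
    constructor
    · rintro ⟨h3, h4⟩
      exact ⟨h3, fun t ht => (h2 h3 t (by simpa using ht)).2 (h4 t (by simpa using ht))⟩
    · rintro ⟨h3, h4⟩
      exact ⟨h3, fun t ht => (h2 h3 t ht).1 (h4 t (by simpa using ht))⟩
  have hα0 : 0 ≤ a / (a + b) := by positivity
  have hα1 : a / (a + b) ≤ 1 := by rw [div_le_one (by positivity)]; linarith
  have hβ : 1 - a / (a + b) = b / (a + b) := by field_simp; ring
  rw [e, mm, Measure.infinitePi_pi _ (fun _ _ => MeasurableSet.of_discrete),
    Finset.prod_insert h0, ENNReal.toReal_mul, ENNReal.toReal_prod]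
  congr 1
  · simp only [hT, if_true, Measure.prod_prod, measure_univ, mul_one, qm]
    rcases hi with rfl | rfl
    · simp only [decide_true]
      exact bern_true (by norm_num) (by norm_num)
    · norm_num
      rw [bern_false (by norm_num) (by norm_num)]; norm_num
  · apply Finset.prod_congr rfl
    intro t ht
    have ht0 : t ≠ 0 := fun h => h0 (h ▸ ht)
    have hpt := hp t (hs t ht)
    simp only [hT, if_neg ht0, Measure.prod_prod, ENNReal.toReal_mul, qm, signalProb]
    congr 1
    · by_cases h : x t = i
      · simp only [h, decide_true, if_true]; exact bern_true hα0 hα1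
      · simp only [h, decide_false, if_false]; rw [bern_false hα0 hα1, hβ]
    · by_cases h : c t = 1
      · simp only [h, decide_true, if_true]; exact bern_true hpt.1 hpt.2
      · simp only [h, decide_false, if_false]; exact bern_false hpt.1 hpt.2

variable {Ω : Type*} [MeasurableSpace Ω]

/-- truncated action histories -/
def Zh (μ : Measure Ω) (θ : Ω → ℕ) (X I : ℕ → Ω → ℕ) : ℕ → ℕ → Ω → ℕ
  | 0 => fun _ _ => 1
  | n + 1 => Function.update (Zh μ θ X I n) (n + 1)
      (fun ω => if I (n + 1) ω = 1 then X (n + 1) ω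
        else mapEst μ θ X (Zh μ θ X I n) (n + 1) ω)

theorem Zh_stable (μ : Measure Ω) (θ : Ω → ℕ) (X I : ℕ → Ω → ℕ) (s n : ℕ) (h : s ≤ n) :
    Zh μ θ X I n s = Zh μ θ X I s s := by
  induction n with
  | zero => have : s = 0 := by omega
            rw [this]
  | succ n ih =>
    rcases Nat.lt_or_ge s (n + 1) with h1 | h1
    · rw [← ih (by omega)]
      conv_lhs => rw [Zh]
      rw [Function.update_of_ne (by omega)]
    · have : s = n + 1 := by omega
      rw [this]

theorem mapEst_congr (μ : Measure Ω) (θ : Ω → ℕ) (X Z Z' : ℕ → Ω → ℕ) (t : ℕ)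
    (h : ∀ s ∈ Finset.Icc 1 (t - 1), Z s = Z' s) : mapEst μ θ X Z t = mapEst μ θ X Z' t := by
  have hD : ∀ i ω, Dlike μ θ X Z t i ω = Dlike μ θ X Z' t i ω := by
    intro i ω
    unfold Dlike
    have : {ω' | θ ω' = i ∧ (∀ s ∈ Finset.Icc 1 (t - 1), Z s ω' = Z s ω) ∧ X t ω' = X t ω} =
        {ω' | θ ω' = i ∧ (∀ s ∈ Finset.Icc 1 (t - 1), Z' s ω' = Z' s ω) ∧ X t ω' = X t ω} := by
      ext ω'
      refine and_congr_right fun _ => and_congr_left fun _ => ?_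
      exact forall₂_congr fun s hs => by rw [h s hs]
    rw [this]
  funext ω
  unfold mapEst
  rw [hD, hD]

theorem Dlike_meas (μ : Measure Ω) (θ : Ω → ℕ) (X Z : ℕ → Ω → ℕ) (t i : ℕ)
    (hX : Measurable (X t)) (hZ : ∀ s ∈ Finset.Icc 1 (t - 1), Measurable (Z s)) :
    Measurable (Dlike μ θ X Z t i) := by
  let G : ℕ × (Finset.Icc 1 (t - 1) → ℕ) → ℝ := fun u =>
    (μ {ω' | θ ω' = i ∧ (∀ s : Finset.Icc 1 (t - 1), Z s ω' = u.2 s) ∧ X t ω' = u.1}).toReal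
      / (μ {ω' | θ ω' = i}).toReal
  have hG : Measurable G := measurable_of_countable _
  have hF : Measurable (fun ω => (X t ω, fun s : Finset.Icc 1 (t - 1) => Z s ω)) :=
    hX.prodMk (measurable_pi_lambda _ fun s => hZ s s.2)
  have : Dlike μ θ X Z t i = G ∘ (fun ω => (X t ω, fun s : Finset.Icc 1 (t - 1) => Z s ω)) := by
    funext ω
    simp only [Dlike, G, Function.comp]
    congr 4
    ext ω'
    simp
  rw [this]
  exact hG.comp hF

theorem mapEst_meas (μ : Measure Ω) (θ : Ω → ℕ) (X Z : ℕ → Ω → ℕ) (t : ℕ)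
    (hX : Measurable (X t)) (hZ : ∀ s ∈ Finset.Icc 1 (t - 1), Measurable (Z s)) :
    Measurable (mapEst μ θ X Z t) := by
  have h1 := Dlike_meas μ θ X Z t 1 hX hZ
  have h2 := Dlike_meas μ θ X Z t 2 hX hZ
  unfold mapEst
  exact Measurable.ite (measurableSet_lt h2 h1) measurable_const
    (Measurable.ite (measurableSet_lt h1 h2) measurable_const hX)

theorem Zh_meas (μ : Measure Ω) (θ : Ω → ℕ) (X I : ℕ → Ω → ℕ) (hX : ∀ t, Measurable (X t))
    (hI : ∀ t, Measurable (I t)) (n : ℕ) : ∀ s, Measurable (Zh μ θ X I n s) := by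
  induction n with
  | zero => intro s; exact measurable_const
  | succ n ih =>
    intro s
    by_cases hs : s = n + 1
    · subst hs
      rw [Zh, Function.update_self]
      exact Measurable.ite (hI _ (measurableSet_singleton 1)) (hX _)
        (mapEst_meas μ θ X _ _ (hX _) fun s _ => ih s)
    · rw [Zh, Function.update_of_ne hs]; exact ih s

theorem exists_model (a b : ℝ) (ha : 0 < a) (hb : 0 < b) (p : ℕ → ℝ)
    (hp : ∀ t, 1 ≤ t → p t ∈ Set.Icc (0:ℝ) 1) :
    IsCascade a b p (mm (a / (a + b)) p) thm Xm Im
      (fun t => Zh (mm (a / (a + b)) p) thm Xm Im t t) where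
  prob := inferInstance
  theta_meas := thm_meas
  X_meas := Xm_meas
  I_meas := Im_meas
  Z_meas := fun t => Zh_meas _ _ _ _ Xm_meas Im_meas t t
  p_mem := hp
  theta_range := thm_range
  X_range := by
    intro t ω
    unfold Xm
    rcases thm_range ω with h | h <;> rw [h] <;> split_ifs <;> simp
  I_range := by
    intro t ω
    unfold Im
    split_ifs <;> simp
  Z_zero := fun ω => rfl
  joint := joint_m a b ha hb p hp
  dynamics := by
    intro t ht ω
    obtain ⟨n, rfl⟩ : ∃ n, t = n + 1 := ⟨t - 1, by omega⟩
    rw [mapEst_congr _ _ _ (fun t => Zh (mm (a / (a + b)) p) thm Xm Im t t)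
      (Zh (mm (a / (a + b)) p) thm Xm Im n) (n + 1)]
    · conv_lhs => rw [Zh, Function.update_self]
    · intro s hs
      rw [Finset.mem_Icc] at hs
      exact (Zh_stable _ _ _ _ s n (by omega)).symm

end Model

theorem optimal_learning_rate (a b : ℝ) (hb : 0 < b) (hab : b < a) :
    sInf {x : ℝ≥0∞ |
      ∃ (p : ℕ → ℝ) (Ω : Type) (m : MeasurableSpace Ω) (μ : @Measure Ω m)
        (θ : Ω → ℕ) (X I Z : ℕ → Ω → ℕ),
        @IsCascade a b p Ω m μ θ X I Z ∧
        x = Filter.limsup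
              (fun t : ℕ => (t : ℝ≥0∞) * μ {ω | Z t ω ≠ θ ω}) Filter.atTop}
      = ENNReal.ofReal (kappaStar a b) := by
  have ha : 0 < a := hb.trans hab
  obtain ⟨lam, m, σ, γ, hlam, hl, hm0, hml, hm, hσ0, hσ1, hγ, hγ0, hk⟩ :=
    constants_exist a b hb hab (a / (a + b)) (b / (a + b)) rfl rfl
  have hβ : 0 < b / (a + b) := by positivity
  have hlt : b / (a + b) < a / (a + b) := by gcongr
  have hs : a / (a + b) + b / (a + b) = 1 := by field_simp
  rw [hk]
  apply le_antisymm
  · refine ENNReal.le_of_forall_pos_le_add fun ε hε _ => ?_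
    have hεr : (0:ℝ) < ε := hε
    set c : ℝ := 1 / γ + (ε:ℝ) / (2 * (b / (a + b))) with hcdef
    have hc : 1 < γ * c := by
      have e1 : γ * c = 1 + γ * ((ε:ℝ) / (2 * (b / (a + b)))) := by
        rw [hcdef]; field_simp
      rw [e1]
      have : 0 < γ * ((ε:ℝ) / (2 * (b / (a + b)))) := by positivity
      linarith
    have hc0 : 0 < c := by rw [hcdef]; positivity
    obtain ⟨p, hp, hev⟩ := det_upper hβ hlt hs hm hσ0 hσ1 hγ hγ0 hc hc0 ((ε:ℝ) / 2) (by positivity)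
    have hmod := exists_model a b ha hb p hp
    refine le_trans (b := Filter.limsup (fun t : ℕ => (t : ℝ≥0∞) * (mm (a / (a + b)) p)
      {ω | Zh (mm (a / (a + b)) p) thm Xm Im t t ω ≠ thm ω}) Filter.atTop) ?_ ?_
    · apply sInf_le
      exact ⟨p, _, _, _, _, _, _, _, hmod, rfl⟩
    have hsum : c * (b / (a + b)) + (ε:ℝ) / 2 = b / (a + b) / γ + ε := by
      rw [hcdef]; field_simp; ring
    have hgoal : ENNReal.ofReal (b / (a + b) / γ) + (ε : ℝ≥0∞) =
        ENNReal.ofReal (c * (b / (a + b)) + (ε:ℝ) / 2) := by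
      rw [hsum, ENNReal.ofReal_add (by positivity) hεr.le, ENNReal.ofReal_coe_nnreal]
    rw [hgoal]
    refine Filter.limsup_le_of_le (by isBoundedDefault) ?_
    rw [← Filter.map_add_atTop_eq_nat 1, Filter.eventually_map]
    filter_upwards [hev] with t ht
    rw [← err_eq hmod t] at ht
    rw [← ENNReal.ofReal_toReal (measure_ne_top (mm (a / (a + b)) p) _),
      show ((t + 1 : ℕ) : ℝ≥0∞) = ENNReal.ofReal ((t:ℝ) + 1) by
        rw [← Nat.cast_succ, ENNReal.ofReal_natCast],
      ← ENNReal.ofReal_mul (by positivity)]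
    exact ENNReal.ofReal_le_ofReal ht
  · refine le_sInf ?_
    rintro x ⟨p, Ω, mΩ, μ, θ, X, I, Z, h, rfl⟩
    haveI := h.prob
    by_contra hlt'
    rw [not_le] at hlt'
    obtain ⟨y, hy1, hy2⟩ := ENNReal.lt_iff_exists_nnreal_btwn.mp hlt'
    have hyk : (y:ℝ) < b / (a + b) / γ := by
      rw [← ENNReal.ofReal_coe_nnreal] at hy2
      exact (ENNReal.ofReal_lt_ofReal_iff (by positivity)).mp hy2
    refine det_lower hβ hlt hs hlam hl hm0 hml hm hσ0 hσ1 hγ hγ0 y.2 hyk h.p_mem ?_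
    have hev := Filter.eventually_lt_of_limsup_lt hy1
    rw [← Filter.map_add_atTop_eq_nat 1, Filter.eventually_map] at hev
    filter_upwards [hev] with t ht
    rw [← err_eq h t]
    have := ENNReal.toReal_mono ENNReal.coe_ne_top ht.le
    rw [ENNReal.toReal_mul, ENNReal.toReal_natCast] at this
    simpa using this
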